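/- Let (X, 𝓑, μ, T) be an m.t.d.s., 𝓤 a cover of X, and let μ = ∫ μ_x dμ(x) be the ergodic decomposition of μ with respect to T. Then h_μ^+(𝓤, T) = ∫ h_{μ_x}^+(𝓤, T) dμ(x) and h_μ^−(𝓤, T) = ∫ h_{μ_x}^−(𝓤, T) dμ(x). -/

import Mathlib

open MeasureTheory Filter Topology
open scoped Classical

variable {X : Type*} [MeasurableSpace X]

noncomputable def cJoin (U V : Finset (Set X)) : Finset (Set X) :=
  (U ×ˢ V).image fun p => p.1 ∩ p.2

noncomputable def preC (S : X → X) (U : Finset (Set X)) : Finset (Set X) :=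
  U.image fun A => S ⁻¹' A

noncomputable def joinN (S : X → X) (U : Finset (Set X)) : ℕ → Finset (Set X)
  | 0 => {Set.univ}
  | n + 1 => cJoin (joinN S U n) (preC (S^[n]) U)

def IsMCover (U : Finset (Set X)) : Prop :=
  (∀ A ∈ U, MeasurableSet A) ∧ ⋃₀ (U : Set (Set X)) = Set.univ

def IsMPartition (U : Finset (Set X)) : Prop :=
  IsMCover U ∧ ∀ A ∈ U, ∀ B ∈ U, A ≠ B → Disjoint A B

def Refines (α U : Finset (Set X)) : Prop := ∀ A ∈ α, ∃ B ∈ U, A ⊆ B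

noncomputable def entPart (μ : Measure X) (α : Finset (Set X)) : ℝ :=
  ∑ A ∈ α, Real.negMulLog (μ A).toReal

noncomputable def entCover (μ : Measure X) (U : Finset (Set X)) : ℝ :=
  sInf {h | ∃ α : Finset (Set X), IsMPartition α ∧ Refines α U ∧ h = entPart μ α}

noncomputable def hPart (μ : Measure X) (S : X → X) (α : Finset (Set X)) : ℝ :=
  limUnder atTop fun n : ℕ => entPart μ (joinN S α n) / n

noncomputable def hPlusC (μ : Measure X) (S : X → X) (U : Finset (Set X)) : ℝ :=
  sInf {h | ∃ α : Finset (Set X), IsMPartition α ∧ Refines α U ∧ h = hPart μ S α}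

noncomputable def hMinusC (μ : Measure X) (S : X → X) (U : Finset (Set X)) : ℝ :=
  limUnder atTop fun n : ℕ => entCover μ (joinN S U n) / n

noncomputable def covN (μ : Measure X) (V : Finset (Set X)) (ε : ℝ) : ℕ :=
  sInf {m | ∃ W ⊆ V, W.card = m ∧ 1 - ε < (μ (⋃₀ (W : Set (Set X)))).toReal}

noncomputable def covNfull (V : Finset (Set X)) : ℕ :=
  sInf {m | ∃ W ⊆ V, W.card = m ∧ ⋃₀ (W : Set (Set X)) = Set.univ}

section FiniteEntropy

variable {ι κ : Type*}

/-- Every preimage under `a` is measurable: measurability with respect to the discrete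
`σ`-algebra on the target. -/
def DiscMeas (a : X → ι) : Prop := ∀ s : Set ι, MeasurableSet (a ⁻¹' s)

theorem DiscMeas.of_singleton [Countable ι] {a : X → ι}
    (h : ∀ i, MeasurableSet (a ⁻¹' {i})) : DiscMeas a := by
  intro s
  rw [← Set.biUnion_preimage_singleton]
  exact MeasurableSet.biUnion s.to_countable fun i _ => h i

theorem DiscMeas.left_comp {a : X → ι} (h : DiscMeas a) (φ : ι → κ) :
    DiscMeas fun x => φ (a x) := fun s => h (φ ⁻¹' s)

theorem DiscMeas.right_comp {a : X → ι} (h : DiscMeas a) {S : X → X} (hS : Measurable S) :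
    DiscMeas fun x => a (S x) := fun s => hS (h s)

theorem DiscMeas.prodMk [Countable ι] [Countable κ] {a : X → ι} {b : X → κ} (ha : DiscMeas a)
    (hb : DiscMeas b) : DiscMeas fun x => (a x, b x) := by
  refine .of_singleton fun p => ?_
  have : (fun x => (a x, b x)) ⁻¹' {p} = a ⁻¹' {p.1} ∩ b ⁻¹' {p.2} := by
    ext x; simp [Prod.ext_iff]
  rw [this]
  exact (ha _).inter (hb _)

theorem DiscMeas.pi [Finite ι] [Finite κ] {a : X → κ → ι} (ha : ∀ k, DiscMeas fun x => a x k) :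
    DiscMeas a := by
  refine .of_singleton fun p => ?_
  have : a ⁻¹' {p} = ⋂ k, (fun x => a x k) ⁻¹' {p k} := by
    ext x; simp [funext_iff]
  rw [this]
  exact MeasurableSet.iInter fun k => ha k _

theorem Real.negMulLog_sum_le (s : Finset ι) (p : ι → ℝ) (hp : ∀ i ∈ s, 0 ≤ p i) :
    Real.negMulLog (∑ i ∈ s, p i) ≤ ∑ i ∈ s, Real.negMulLog (p i) := by
  have h1 : Real.negMulLog (∑ i ∈ s, p i) = ∑ i ∈ s, -p i * Real.log (∑ i ∈ s, p i) := by
    simp [Real.negMulLog, Finset.sum_mul]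
  rw [h1]
  refine Finset.sum_le_sum fun i hi => ?_
  rcases (hp i hi).eq_or_lt with h0 | h0
  · simp [← h0]
  · have := Real.log_le_log h0 (Finset.single_le_sum hp hi)
    simp only [Real.negMulLog]
    nlinarith

theorem Real.negMulLog_le_of_mul {p x y : ℝ} (hp : 0 ≤ p) (hpx : p ≤ x) (hpy : p ≤ y) :
    Real.negMulLog p ≤ -p * Real.log x + -p * Real.log y + (x * y - p) := by
  rcases hp.eq_or_lt with h0 | h0
  · subst h0
    simpa using mul_nonneg hpx hpy
  · have hx : 0 < x := h0.trans_le hpx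
    have hy : 0 < y := h0.trans_le hpy
    have h := Real.log_le_sub_one_of_pos (show 0 < x * y / p by positivity)
    rw [Real.log_div (by positivity) h0.ne', Real.log_mul hx.ne' hy.ne'] at h
    have h2 := mul_le_mul_of_nonneg_left h hp
    have h3 : p * (x * y / p - 1) = x * y - p := by field_simp
    rw [h3] at h2
    simp only [Real.negMulLog]
    linarith

/-- Shannon entropy of a finite-valued function. -/
noncomputable def shannon [Fintype ι] (ν : Measure X) (a : X → ι) : ℝ :=
  ∑ i, Real.negMulLog (ν.real (a ⁻¹' {i}))

variable [Fintype ι] [Fintype κ] (ν : Measure X)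

theorem shannon_comp_measurePreserving {S : X → X} (hS : MeasurePreserving S ν ν) {a : X → ι}
    (ha : DiscMeas a) : shannon ν (fun x => a (S x)) = shannon ν a := by
  refine Finset.sum_congr rfl fun i _ => ?_
  rw [← hS.measureReal_preimage (ha {i}).nullMeasurableSet]
  rfl

theorem shannon_congr {a b : X → ι} (h : a =ᵐ[ν] b) : shannon ν a = shannon ν b := by
  refine Finset.sum_congr rfl fun i _ => ?_
  rw [measureReal_congr (h.preimage {i})]

theorem shannon_le_card (a : X → ι) : shannon ν a ≤ Fintype.card ι := by
  have : shannon ν a ≤ ∑ _i : ι, (1 : ℝ) := by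
    refine Finset.sum_le_sum fun i _ => ?_
    have h0 : 0 ≤ ν.real (a ⁻¹' {i}) := measureReal_nonneg
    linarith [Real.negMulLog_le_one_sub_self h0]
  simpa using this

variable [IsProbabilityMeasure ν]

theorem shannon_nonneg (a : X → ι) : 0 ≤ shannon ν a :=
  Finset.sum_nonneg fun _ _ => Real.negMulLog_nonneg measureReal_nonneg measureReal_le_one

theorem measureReal_preimage_eq_sum {a : X → ι} (ha : DiscMeas a) (s : Set ι) :
    ν.real (a ⁻¹' s) = ∑ i with i ∈ s, ν.real (a ⁻¹' {i}) := by
  rw [← measureReal_biUnion_finset]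
  · congr 1
    ext x; simp
  · intro i _ j _ hij
    exact Disjoint.preimage _ (by simpa using hij)
  · exact fun i _ => ha _

theorem shannon_comp_le {a : X → ι} (ha : DiscMeas a) (φ : ι → κ) :
    shannon ν (fun x => φ (a x)) ≤ shannon ν a := by
  have h1 : shannon ν a = ∑ k, ∑ i with φ i = k, Real.negMulLog (ν.real (a ⁻¹' {i})) := by
    exact (Finset.sum_fiberwise Finset.univ φ _).symm
  rw [h1]
  refine Finset.sum_le_sum fun k _ => ?_
  have h2 := measureReal_preimage_eq_sum ν ha (φ ⁻¹' {k})
  have h3 : (fun x => φ (a x)) ⁻¹' {k} = a ⁻¹' (φ ⁻¹' {k}) := rfl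
  rw [h3, h2]
  simp only [Set.mem_preimage, Set.mem_singleton_iff]
  exact Real.negMulLog_sum_le _ _ fun i _ => measureReal_nonneg

theorem shannon_le_of_factor {a : X → ι} {b : X → κ} (ha : DiscMeas a) (φ : ι → κ)
    (h : ∀ x, b x = φ (a x)) : shannon ν b ≤ shannon ν a := by
  obtain rfl : b = fun x => φ (a x) := funext h
  exact shannon_comp_le ν ha φ

theorem shannon_prod_le {a : X → ι} {b : X → κ} (ha : DiscMeas a) (hb : DiscMeas b) :
    shannon ν (fun x => (a x, b x)) ≤ shannon ν a + shannon ν b := by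
  set p : ι × κ → ℝ := fun q => ν.real ((fun x => (a x, b x)) ⁻¹' {q}) with hp
  have hab := ha.prodMk hb
  have hA : ∀ i, ν.real (a ⁻¹' {i}) = ∑ j, p (i, j) := by
    intro i
    have h := measureReal_preimage_eq_sum ν hab {q | q.1 = i}
    have e : (fun x => (a x, b x)) ⁻¹' {q | q.1 = i} = a ⁻¹' {i} := by ext x; simp
    rw [e] at h
    rw [h]
    simp only [Set.mem_ofPred_eq]
    rw [Finset.sum_filter, Fintype.sum_prod_type, Finset.sum_eq_single i]
    · simp [hp]
    · intro j _ hj; simp [hj]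
    · simp
  have hB : ∀ j, ν.real (b ⁻¹' {j}) = ∑ i, p (i, j) := by
    intro j
    have h := measureReal_preimage_eq_sum ν hab {q | q.2 = j}
    have e : (fun x => (a x, b x)) ⁻¹' {q | q.2 = j} = b ⁻¹' {j} := by ext x; simp
    rw [e] at h
    rw [h]
    simp only [Set.mem_ofPred_eq]
    rw [Finset.sum_filter, Fintype.sum_prod_type_right, Finset.sum_eq_single j]
    · simp [hp]
    · intro j _ hj; simp [hj]
    · simp
  have p0 : ∀ q, 0 ≤ p q := fun q => measureReal_nonneg
  have oneA : ∑ i, ν.real (a ⁻¹' {i}) = 1 := by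
    have h := measureReal_preimage_eq_sum ν ha Set.univ
    simpa using h.symm
  have oneB : ∑ i, ν.real (b ⁻¹' {i}) = 1 := by
    have h := measureReal_preimage_eq_sum ν hb Set.univ
    simpa using h.symm
  have oneP : ∑ i, ∑ j, p (i, j) = 1 := by simp_rw [← hA]; exact oneA
  have key : shannon ν (fun x => (a x, b x)) ≤ ∑ i, ∑ j,
      (-p (i, j) * Real.log (ν.real (a ⁻¹' {i})) + -p (i, j) * Real.log (ν.real (b ⁻¹' {j}))
        + (ν.real (a ⁻¹' {i}) * ν.real (b ⁻¹' {j}) - p (i, j))) := by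
    rw [shannon, Fintype.sum_prod_type]
    refine Finset.sum_le_sum fun i _ => Finset.sum_le_sum fun j _ => ?_
    refine Real.negMulLog_le_of_mul (p0 _) ?_ ?_
    · rw [hA]
      exact Finset.single_le_sum (f := fun j => p (i, j)) (fun _ _ => p0 _) (Finset.mem_univ j)
    · rw [hB]
      exact Finset.single_le_sum (f := fun i => p (i, j)) (fun _ _ => p0 _) (Finset.mem_univ i)
  refine key.trans (le_of_eq ?_)
  simp only [Finset.sum_add_distrib, Finset.sum_sub_distrib]
  rw [oneP]
  have e1 : ∑ i, ∑ j, -p (i, j) * Real.log (ν.real (a ⁻¹' {i})) = shannon ν a := by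
    refine Finset.sum_congr rfl fun i _ => ?_
    rw [← Finset.sum_mul, Finset.sum_neg_distrib, ← hA]; rfl
  have e2 : ∑ i, ∑ j, -p (i, j) * Real.log (ν.real (b ⁻¹' {j})) = shannon ν b := by
    rw [Finset.sum_comm]
    refine Finset.sum_congr rfl fun i _ => ?_
    rw [← Finset.sum_mul, Finset.sum_neg_distrib, ← hB]; rfl
  have e3 : ∑ i, ∑ j, ν.real (a ⁻¹' {i}) * ν.real (b ⁻¹' {j}) = 1 := by
    simp_rw [← Finset.mul_sum, oneB, mul_one, oneA]
  rw [e1, e2, e3]; ring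

end FiniteEntropy

section Rate

variable {ι κ : Type*}

/-- The length `n` itinerary of a point with respect to the labelling `a`. -/
def itin {X : Type*} (S : X → X) (a : X → ι) (n : ℕ) : X → Fin n → ι := fun x i => a (S^[i] x)

/-- Entropy rate of a finite-valued labelling. -/
noncomputable def rate [Fintype ι] (ν : Measure X) (S : X → X) (a : X → ι) : ℝ :=
  limUnder atTop fun n : ℕ => shannon ν (itin S a n) / n

theorem DiscMeas.itin [Finite ι] {S : X → X} (hS : Measurable S) {a : X → ι} (ha : DiscMeas a)
    (n : ℕ) : DiscMeas (itin S a n) :=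
  .pi fun k => ha.right_comp (hS.iterate k)

theorem itin_add {X : Type*} (S : X → X) (a : X → ι) (n k : ℕ) :
    itin S a (n + k) = fun x => Fin.append (itin S a n x) (itin S a k (S^[n] x)) := by
  funext x i
  refine Fin.addCases (fun i => ?_) (fun i => ?_) i
  · simp [itin]
  · simp [itin, Fin.append_right, add_comm n, Function.iterate_add_apply]

/-- The correction needed to recover `b` from `c`. -/
noncomputable def correction {X : Type*} (b c : X → ι) : X → Option ι :=
  fun x => if b x = c x then none else some (b x)

theorem DiscMeas.correction [Countable ι] {b c : X → ι} (hb : DiscMeas b) (hc : DiscMeas c) :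
    DiscMeas (correction b c) :=
  (hb.prodMk hc).left_comp fun p => if p.1 = p.2 then none else some p.1

variable [Fintype ι] [Fintype κ] (ν : Measure X)

theorem rate_congr {S : X → X} (hS : MeasurePreserving S ν ν) {a b : X → ι} (h : a =ᵐ[ν] b) :
    rate ν S a = rate ν S b := by
  have : ∀ n, shannon ν (itin S a n) = shannon ν (itin S b n) := fun n => by
    refine shannon_congr ν ?_
    have h' : ∀ i : Fin n, ∀ᵐ x ∂ν, a (S^[i] x) = b (S^[i] x) := fun i =>
      (hS.iterate i).quasiMeasurePreserving.ae h
    filter_upwards [ae_all_iff.2 h'] with x hx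
    funext i
    exact hx i
  simp [rate, this]

variable [IsProbabilityMeasure ν]

theorem subadditive_shannon_itin {S : X → X} (hS : MeasurePreserving S ν ν) {a : X → ι}
    (ha : DiscMeas a) : Subadditive fun n => shannon ν (itin S a n) := by
  intro n k
  have hn := ha.itin hS.measurable n
  have hk := ha.itin hS.measurable k
  have hk' := hk.right_comp (hS.iterate n).measurable
  calc shannon ν (itin S a (n + k))
    _ = shannon ν (fun x => Fin.append (itin S a n x) (itin S a k (S^[n] x))) := by
        rw [itin_add]
    _ ≤ shannon ν (fun x => (itin S a n x, itin S a k (S^[n] x))) :=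
        shannon_comp_le ν (hn.prodMk hk') fun p => Fin.append p.1 p.2
    _ ≤ _ := shannon_prod_le ν hn hk'
    _ = _ := by rw [shannon_comp_measurePreserving ν (hS.iterate n) hk]

theorem bddBelow_shannon_itin (S : X → X) (a : X → ι) :
    BddBelow (Set.range fun n : ℕ => shannon ν (itin S a n) / n) :=
  ⟨0, by rintro _ ⟨n, rfl⟩; exact div_nonneg (shannon_nonneg ν _) n.cast_nonneg⟩

theorem tendsto_rate {S : X → X} (hS : MeasurePreserving S ν ν) {a : X → ι} (ha : DiscMeas a) :
    Tendsto (fun n : ℕ => shannon ν (itin S a n) / n) atTop (𝓝 (rate ν S a)) :=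
  tendsto_nhds_limUnder
    ⟨_, (subadditive_shannon_itin ν hS ha).tendsto_lim (bddBelow_shannon_itin ν S a)⟩

theorem rate_eq_lim {S : X → X} (hS : MeasurePreserving S ν ν) {a : X → ι} (ha : DiscMeas a) :
    rate ν S a = (subadditive_shannon_itin ν hS ha).lim :=
  tendsto_nhds_unique (tendsto_rate ν hS ha)
    ((subadditive_shannon_itin ν hS ha).tendsto_lim (bddBelow_shannon_itin ν S a))

theorem rate_le_div {S : X → X} (hS : MeasurePreserving S ν ν) {a : X → ι} (ha : DiscMeas a)
    {n : ℕ} (hn : n ≠ 0) : rate ν S a ≤ shannon ν (itin S a n) / n := by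
  rw [rate_eq_lim ν hS ha]
  exact (subadditive_shannon_itin ν hS ha).lim_le_div (bddBelow_shannon_itin ν S a) hn

theorem rate_eq_iInf {S : X → X} (hS : MeasurePreserving S ν ν) {a : X → ι} (ha : DiscMeas a) :
    rate ν S a = ⨅ n : ℕ, shannon ν (itin S a (n + 1)) / (n + 1 : ℕ) := by
  have hb : BddBelow (Set.range fun n : ℕ => shannon ν (itin S a (n + 1)) / (n + 1 : ℕ)) :=
    ⟨0, by rintro _ ⟨n, rfl⟩; exact div_nonneg (shannon_nonneg ν _) (n + 1).cast_nonneg⟩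
  refine le_antisymm (le_ciInf fun n => rate_le_div ν hS ha n.succ_ne_zero) ?_
  exact ge_of_tendsto' ((tendsto_rate ν hS ha).comp (tendsto_add_atTop_nat 1))
    fun n => ciInf_le hb n

theorem rate_nonneg {S : X → X} (hS : MeasurePreserving S ν ν) {a : X → ι} (ha : DiscMeas a) :
    0 ≤ rate ν S a :=
  ge_of_tendsto' (tendsto_rate ν hS ha) fun n =>
    div_nonneg (shannon_nonneg ν _) n.cast_nonneg

theorem shannon_itin_zero (S : X → X) (a : X → ι) : shannon ν (itin S a 0) = 0 := by
  have : ∀ i, itin S a 0 ⁻¹' {i} = Set.univ := fun i => by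
    ext x; simp [Subsingleton.elim (itin S a 0 x) i]
  simp [shannon, this]

theorem shannon_itin_one {S : X → X} {a : X → ι} (ha : DiscMeas a) :
    shannon ν (itin S a 1) ≤ shannon ν a := by
  have : itin S a 1 = fun x (_ : Fin 1) => a x := by
    funext x i; simp [itin, Subsingleton.elim i 0]
  rw [this]
  exact shannon_comp_le ν ha fun i (_ : Fin 1) => i

theorem shannon_itin_le {S : X → X} (hS : MeasurePreserving S ν ν) {a : X → ι} (ha : DiscMeas a)
    (n : ℕ) : shannon ν (itin S a n) ≤ n * shannon ν a := by
  induction n with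
  | zero => simp [shannon_itin_zero]
  | succ n ih =>
    have h1 := subadditive_shannon_itin ν hS ha n 1
    have h2 := shannon_itin_one ν (S := S) ha
    push_cast
    simp only at h1
    linarith

theorem shannon_itin_div_le {S : X → X} (hS : MeasurePreserving S ν ν) {a : X → ι}
    (ha : DiscMeas a) (n : ℕ) : shannon ν (itin S a n) / n ≤ shannon ν a := by
  rcases n.eq_zero_or_pos with rfl | hn
  · simpa using shannon_nonneg ν a
  · rw [div_le_iff₀ (by positivity), mul_comm]
    exact shannon_itin_le ν hS ha n

theorem rate_le_shannon {S : X → X} (hS : MeasurePreserving S ν ν) {a : X → ι}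
    (ha : DiscMeas a) : rate ν S a ≤ shannon ν a :=
  le_of_tendsto' (tendsto_rate ν hS ha) fun n => shannon_itin_div_le ν hS ha n

theorem rate_comp_le {S : X → X} (hS : MeasurePreserving S ν ν) {a : X → ι} (ha : DiscMeas a)
    (φ : ι → κ) : rate ν S (fun x => φ (a x)) ≤ rate ν S a := by
  refine le_of_tendsto_of_tendsto' (tendsto_rate ν hS (ha.left_comp φ)) (tendsto_rate ν hS ha)
    fun n => ?_
  gcongr
  exact shannon_comp_le ν (ha.itin hS.measurable n) fun w i => φ (w i)

theorem shannon_le_add_correction {b c : X → ι} (hb : DiscMeas b) (hc : DiscMeas c) :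
    shannon ν b ≤ shannon ν c + shannon ν (correction b c) := by
  have hd := hb.correction hc
  refine (shannon_le_of_factor ν (hc.prodMk hd) (fun p => p.2.getD p.1) fun x => ?_).trans
    (shannon_prod_le ν hc hd)
  by_cases h : b x = c x <;> simp [_root_.correction, h]

theorem rate_le_add_correction {S : X → X} (hS : MeasurePreserving S ν ν) {b c : X → ι}
    (hb : DiscMeas b) (hc : DiscMeas c) :
    rate ν S b ≤ rate ν S c + shannon ν (correction b c) := by
  have hd := hb.correction hc
  refine le_of_tendsto_of_tendsto' (tendsto_rate ν hS hb)
    ((tendsto_rate ν hS hc).add_const _) fun n => ?_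
  have hc' := hc.itin hS.measurable n
  have hd' := hd.itin hS.measurable n
  have h1 : shannon ν (itin S b n) ≤
      shannon ν (itin S c n) + shannon ν (itin S (correction b c) n) := by
    refine (shannon_le_of_factor ν (hc'.prodMk hd') (fun p i => (p.2 i).getD (p.1 i))
      fun x => ?_).trans (shannon_prod_le ν hc' hd')
    funext i
    by_cases h : b (S^[i] x) = c (S^[i] x) <;> simp [_root_.correction, _root_.itin, h]
  have h2 := shannon_itin_div_le ν hS hd n
  calc shannon ν (itin S b n) / n ≤
      (shannon ν (itin S c n) + shannon ν (itin S (correction b c) n)) / n := by gcongr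
    _ = shannon ν (itin S c n) / n + shannon ν (itin S (correction b c) n) / n := add_div _ _ _
    _ ≤ _ := by gcongr

theorem exists_shannon_correction_le (ι : Type*) [Fintype ι] {ε : ℝ} (hε : 0 < ε) :
    ∃ δ > 0, ∀ (ν : Measure X) [IsProbabilityMeasure ν] (b c : X → ι), DiscMeas b → DiscMeas c →
      ν.real {x | b x ≠ c x} < δ → shannon ν (correction b c) ≤ ε := by
  set N : ℝ := Fintype.card ι + 1 with hN
  have hNpos : 0 < N := by positivity
  have hcont := Metric.continuousAt_iff.1 (Real.continuous_negMulLog.continuousAt (x := 0))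
    (ε / N) (by positivity)
  obtain ⟨δ, hδ, hδ'⟩ := hcont
  refine ⟨min δ (ε / N), lt_min hδ (by positivity), fun ν _ b c hb hc h => ?_⟩
  have hset : MeasurableSet {x | b x ≠ c x} := (hb.prodMk hc) {p | p.1 ≠ p.2}
  rw [shannon, Fintype.sum_option]
  have h1 : Real.negMulLog (ν.real (correction b c ⁻¹' {none})) ≤ ε / N := by
    refine (Real.negMulLog_le_one_sub_self measureReal_nonneg).trans ?_
    have : correction b c ⁻¹' {none} = {x | b x ≠ c x}ᶜ := by
      ext x; simp [_root_.correction]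
    rw [this, probReal_compl_eq_one_sub hset]
    linarith [min_le_right δ (ε / N)]
  have h2 : ∀ i, Real.negMulLog (ν.real (correction b c ⁻¹' {some i})) ≤ ε / N := by
    intro i
    have hle : ν.real (correction b c ⁻¹' {some i}) ≤ ν.real {x | b x ≠ c x} := by
      refine measureReal_mono fun x hx => ?_
      intro h
      simp [_root_.correction, h] at hx
    have h0 : 0 ≤ ν.real (correction b c ⁻¹' {some i}) := measureReal_nonneg
    have := @hδ' (ν.real (correction b c ⁻¹' {some i})) (by
      rw [Real.dist_eq, sub_zero, abs_of_nonneg h0]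
      linarith [min_le_left δ (ε / N)])
    rw [Real.dist_eq, Real.negMulLog_zero, sub_zero] at this
    exact (le_abs_self _).trans this.le
  calc _ ≤ ε / N + ∑ _i : ι, ε / N := add_le_add h1 (Finset.sum_le_sum fun i _ => h2 i)
    _ = ε := by
      simp only [Finset.sum_const, Finset.card_univ, nsmul_eq_mul]
      field_simp
      rw [hN]; ring

end Rate

section CoverEntropy

variable {ι : Type*}

/-- The cells of a labelling with finitely many labels. -/
noncomputable def cells {X : Type*} [Fintype ι] (a : X → ι) : Finset (Set X) :=
  Finset.univ.image fun i => a ⁻¹' {i}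

theorem mem_cells {X : Type*} [Fintype ι] {a : X → ι} {A : Set X} :
    A ∈ cells a ↔ ∃ i, a ⁻¹' {i} = A := by
  simp [cells]

theorem entPart_cells [Fintype ι] (ν : Measure X) (a : X → ι) :
    entPart ν (cells a) = shannon ν a := by
  rw [entPart, cells, Finset.sum_image_of_pairwise_eq_zero]
  · rfl
  · intro i _ j _ hij h
    have : a ⁻¹' {i} = ∅ := by
      ext x
      simp only [Set.mem_preimage, Set.mem_singleton_iff, Set.mem_empty_iff_false, iff_false]
      intro hx
      have hx' : x ∈ a ⁻¹' {j} := h ▸ hx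
      exact hij (hx.symm.trans hx')
    simp [this]

theorem isMPartition_cells [Fintype ι] {a : X → ι} (ha : DiscMeas a) :
    IsMPartition (cells a) := by
  refine ⟨⟨fun A hA => ?_, ?_⟩, fun A hA B hB hAB => ?_⟩
  · obtain ⟨i, rfl⟩ := mem_cells.1 hA
    exact ha _
  · refine Set.eq_univ_of_forall fun x => ⟨a ⁻¹' {a x}, ?_, rfl⟩
    exact mem_cells.2 ⟨_, rfl⟩
  · obtain ⟨i, rfl⟩ := mem_cells.1 hA
    obtain ⟨j, rfl⟩ := mem_cells.1 hB
    refine Disjoint.preimage _ (Set.disjoint_singleton.2 ?_)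
    rintro rfl
    exact hAB rfl

theorem exists_labelling_of_isMPartition {α : Finset (Set X)} (h : IsMPartition α) :
    ∃ a : X → α, DiscMeas a ∧ (∀ x, x ∈ (a x : Set X)) ∧ cells a = α := by
  have hx : ∀ x, ∃ A : α, x ∈ (A : Set X) := fun x => by
    obtain ⟨A, hA, hxA⟩ := h.1.2.symm ▸ Set.mem_univ x
    exact ⟨⟨A, hA⟩, hxA⟩
  choose a ha using hx
  have hpre : ∀ A : α, a ⁻¹' {A} = A := fun A => by
    ext x
    refine ⟨fun hx => ?_, fun hx => ?_⟩
    · rw [← show a x = A from hx]; exact ha x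
    · by_contra hne
      exact Set.disjoint_left.1 (h.2 _ (a x).2 _ A.2 fun e => hne (Subtype.ext e)) (ha x) hx
  refine ⟨a, .of_singleton fun A => ?_, ha, ?_⟩
  · rw [hpre]; exact h.1.1 _ A.2
  · ext A
    simp [mem_cells, hpre]

theorem mem_joinN {X : Type*} {S : X → X} {U : Finset (Set X)} {n : ℕ} {A : Set X} :
    A ∈ joinN S U n ↔
      ∃ s : ℕ → Set X, (∀ i < n, s i ∈ U) ∧ A = {x | ∀ i < n, S^[i] x ∈ s i} := by
  induction n generalizing A with
  | zero => simp [joinN]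
  | succ n ih =>
    simp only [joinN, cJoin, preC, Finset.mem_image, Finset.mem_product, Prod.exists]
    constructor
    · rintro ⟨B, C, ⟨hB, D, hD, rfl⟩, rfl⟩
      obtain ⟨s, hs, rfl⟩ := ih.1 hB
      refine ⟨fun i => if i < n then s i else D, fun i _ => ?_, ?_⟩
      · by_cases h : i < n
        · simpa [h] using hs i h
        · simpa [h] using hD
      · ext x
        simp only [Set.mem_inter_iff, Set.mem_ofPred_eq, Set.mem_preimage, Nat.forall_lt_succ_right]
        refine and_congr (forall₂_congr fun i hi => by simp [hi]) (by simp)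
    · rintro ⟨s, hs, rfl⟩
      refine ⟨{x | ∀ i < n, S^[i] x ∈ s i}, S^[n] ⁻¹' s n, ⟨ih.2 ⟨s, fun i hi => hs i (by omega),
        rfl⟩, s n, hs n (by omega), rfl⟩, ?_⟩
      ext x
      simp only [Set.mem_inter_iff, Set.mem_ofPred_eq, Set.mem_preimage, Nat.forall_lt_succ_right]

theorem joinN_cells {X : Type*} [Fintype ι] (S : X → X) (a : X → ι) (n : ℕ) :
    joinN S (cells a) n = cells (itin S a n) := by
  ext A
  rw [mem_joinN, mem_cells]
  constructor
  · rintro ⟨s, hs, rfl⟩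
    have : ∀ i : Fin n, ∃ j, a ⁻¹' {j} = s i := fun i => mem_cells.1 (hs i i.2)
    choose w hw using this
    refine ⟨w, ?_⟩
    ext x
    simp only [Set.mem_preimage, Set.mem_singleton_iff, funext_iff, Set.mem_ofPred_eq, itin]
    refine ⟨fun h i hi => ?_, fun h i => ?_⟩
    · rw [← hw ⟨i, hi⟩]; exact h ⟨i, hi⟩
    · have := h i i.2
      rw [← hw i] at this
      exact this
  · rintro ⟨w, rfl⟩
    refine ⟨fun i => if h : i < n then a ⁻¹' {w ⟨i, h⟩} else ∅, fun i hi => ?_, ?_⟩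
    · simp only [hi, dif_pos]
      exact mem_cells.2 ⟨_, rfl⟩
    · ext x
      simp only [Set.mem_preimage, Set.mem_singleton_iff, funext_iff, Set.mem_ofPred_eq, itin]
      refine ⟨fun h i hi => by simpa [hi] using h ⟨i, hi⟩, fun h i => ?_⟩
      simpa using h i i.2

theorem hPart_cells [Fintype ι] (ν : Measure X) (S : X → X) (a : X → ι) :
    hPart ν S (cells a) = rate ν S a := by
  simp only [hPart, rate, joinN_cells, entPart_cells]

theorem IsMCover.joinN {S : X → X} (hS : Measurable S) {U : Finset (Set X)} (hU : IsMCover U)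
    (n : ℕ) : IsMCover (joinN S U n) := by
  refine ⟨fun A hA => ?_, Set.eq_univ_of_forall fun x => ?_⟩
  · obtain ⟨s, hs, rfl⟩ := mem_joinN.1 hA
    simp only [Set.ofPred_forall]
    exact .iInter fun i => .iInter fun hi => hS.iterate i (hU.1 _ (hs i hi))
  · have : ∀ i : ℕ, ∃ A ∈ U, S^[i] x ∈ A := fun i => by
      obtain ⟨A, hA, hx⟩ := hU.2.symm ▸ Set.mem_univ (S^[i] x)
      exact ⟨A, hA, hx⟩
    choose s hs hx using this
    exact ⟨_, mem_joinN.2 ⟨s, fun i _ => hs i, rfl⟩, fun i _ => hx i⟩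

/-- A measurable choice, at every point, of an element of `U` containing it. -/
def IsSelector (U : Finset (Set X)) (b : X → U) : Prop :=
  DiscMeas b ∧ ∀ x, x ∈ (b x : Set X)

theorem IsSelector.preimage_subset {U : Finset (Set X)} {b : X → U} (hb : IsSelector U b)
    (A : U) : b ⁻¹' {A} ⊆ A := by
  rintro x rfl
  exact hb.2 x

/-- The label attached to a membership pattern: an element that contains the point and whose
approximating set does too, or else any element containing the point. -/
noncomputable def patternLabel {α : Type*} [Nonempty α] (p : α → Prop × Prop) : α :=
  if h : ∃ u, (p u).1 ∧ (p u).2 then h.choose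
  else if h : ∃ u, (p u).1 then h.choose else Classical.arbitrary α

theorem patternLabel_fst {α : Type*} [Nonempty α] {p : α → Prop × Prop} (h : ∃ u, (p u).1) :
    (p (patternLabel p)).1 := by
  unfold patternLabel
  split_ifs with h'
  · exact h'.choose_spec.1
  · exact h.choose_spec

theorem patternLabel_eq {α : Type*} [Nonempty α] {p : α → Prop × Prop} {u : α} (h : (p u).1)
    (hu : ∀ v, (p v).2 ↔ v = u) : patternLabel p = u := by
  have h' : ∃ u, (p u).1 ∧ (p u).2 := ⟨u, h, (hu u).2 rfl⟩
  unfold patternLabel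
  rw [dif_pos h']
  exact (hu _).1 h'.choose_spec.2

/-- The selector obtained from a family of approximating sets. -/
noncomputable def selectorOf {X : Type*} (U : Finset (Set X)) [Nonempty U] (B : U → Set X) :
    X → U :=
  fun x => patternLabel fun u => (x ∈ (u : Set X), x ∈ B u)

theorem isSelector_selectorOf {U : Finset (Set X)} [Nonempty U] (hU : IsMCover U)
    {B : U → Set X} (hB : ∀ u, MeasurableSet (B u)) : IsSelector U (selectorOf U B) := by
  refine ⟨DiscMeas.left_comp (a := fun x (u : U) => (x ∈ (u : Set X), x ∈ B u)) (.pi fun u => ?_)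
    patternLabel, fun x => ?_⟩
  · have hp : ∀ {C : Set X}, MeasurableSet C → DiscMeas fun x => x ∈ C := fun {C} hC =>
      fun s => (measurable_mem.2 hC) (by trivial)
    exact (hp (hU.1 _ u.2)).prodMk (hp (hB u))
  · obtain ⟨A, hA, hx⟩ := hU.2.symm ▸ Set.mem_univ x
    exact patternLabel_fst (p := fun u : U => (x ∈ (u : Set X), x ∈ B u)) ⟨⟨A, hA⟩, hx⟩

theorem IsMCover.nonempty {X : Type*} [MeasurableSpace X] [Nonempty X] {U : Finset (Set X)}
    (hU : IsMCover U) : Nonempty U := by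
  obtain ⟨A, hA, -⟩ := hU.2.symm ▸ Set.mem_univ (Classical.arbitrary X)
  exact ⟨⟨A, hA⟩⟩

theorem IsMCover.exists_isSelector [Nonempty X] {U : Finset (Set X)} (hU : IsMCover U) :
    ∃ b, IsSelector U b :=
  have := hU.nonempty
  ⟨_, isSelector_selectorOf hU (B := fun _ => ∅) fun _ => .empty⟩

theorem IsSelector.refines {U : Finset (Set X)} {b : X → U} (hb : IsSelector U b) :
    Refines (cells b) U := by
  intro A hA
  obtain ⟨i, rfl⟩ := mem_cells.1 hA
  exact ⟨i, i.2, hb.preimage_subset i⟩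

theorem exists_selector_of_refines {U α : Finset (Set X)} (hα : IsMPartition α)
    (h : Refines α U) : ∃ (a : X → α) (φ : α → U), DiscMeas a ∧ cells a = α ∧
      IsSelector U fun x => φ (a x) := by
  obtain ⟨a, ha, hmem, hcells⟩ := exists_labelling_of_isMPartition hα
  have : ∀ A : α, ∃ B : U, (A : Set X) ⊆ B := fun A => by
    obtain ⟨B, hB, hAB⟩ := h A A.2
    exact ⟨⟨B, hB⟩, hAB⟩
  choose φ hφ using this
  exact ⟨a, φ, ha, hcells, ha.left_comp φ, fun x => hφ _ (hmem x)⟩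

variable (ν : Measure X) [IsProbabilityMeasure ν]

theorem entCover_le_shannon [Fintype ι] {U : Finset (Set X)} {a : X → ι} (ha : DiscMeas a)
    (h : ∀ i, ∃ B ∈ U, a ⁻¹' {i} ⊆ B) : entCover ν U ≤ shannon ν a := by
  refine csInf_le ⟨0, ?_⟩ ⟨cells a, isMPartition_cells ha, fun A hA => ?_,
    (entPart_cells ν a).symm⟩
  · rintro _ ⟨α, -, -, rfl⟩
    exact Finset.sum_nonneg fun A _ =>
      Real.negMulLog_nonneg ENNReal.toReal_nonneg measureReal_le_one
  · obtain ⟨i, rfl⟩ := mem_cells.1 hA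
    exact h i

theorem IsSelector.entCover_le {U : Finset (Set X)} {b : X → U} (hb : IsSelector U b) :
    entCover ν U ≤ shannon ν b :=
  entCover_le_shannon ν hb.1 fun i => ⟨i, i.2, hb.preimage_subset i⟩

theorem exists_isSelector_shannon_lt {U : Finset (Set X)} (hU : IsMCover U) {r : ℝ}
    (hr : entCover ν U < r) : ∃ b, IsSelector U b ∧ shannon ν b < r := by
  have : Nonempty X := nonempty_of_isProbabilityMeasure ν
  obtain ⟨b₀, hb₀⟩ := hU.exists_isSelector
  obtain ⟨_, ⟨α, hα, hαU, rfl⟩, hlt⟩ := exists_lt_of_csInf_lt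
    (by exact ⟨_, cells b₀, isMPartition_cells hb₀.1, hb₀.refines, rfl⟩) hr
  obtain ⟨a, φ, ha, hcells, hsel⟩ := exists_selector_of_refines hα hαU
  refine ⟨_, hsel, (shannon_comp_le ν ha φ).trans_lt ?_⟩
  rwa [← entPart_cells, hcells]

theorem entCover_nonneg {U : Finset (Set X)} : 0 ≤ entCover ν U := by
  refine Real.sInf_nonneg ?_
  rintro _ ⟨α, -, -, rfl⟩
  exact Finset.sum_nonneg fun A _ =>
    Real.negMulLog_nonneg ENNReal.toReal_nonneg measureReal_le_one

theorem entCover_le_card {U : Finset (Set X)} (hU : IsMCover U) : entCover ν U ≤ U.card := by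
  have : Nonempty X := nonempty_of_isProbabilityMeasure ν
  obtain ⟨b, hb⟩ := hU.exists_isSelector
  refine (hb.entCover_le ν).trans ((shannon_le_card ν b).trans_eq ?_)
  simp

variable {S : X → X}

theorem hPlusC_nonneg (hS : MeasurePreserving S ν ν) {U : Finset (Set X)} :
    0 ≤ hPlusC ν S U := by
  refine Real.sInf_nonneg ?_
  rintro _ ⟨α, hα, -, rfl⟩
  obtain ⟨a, ha, -, hcells⟩ := exists_labelling_of_isMPartition hα
  rw [← hcells, hPart_cells]
  exact rate_nonneg ν hS ha

theorem IsSelector.hPlusC_le (hS : MeasurePreserving S ν ν) {U : Finset (Set X)} {b : X → U}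
    (hb : IsSelector U b) : hPlusC ν S U ≤ rate ν S b := by
  refine csInf_le ⟨0, ?_⟩ ⟨cells b, isMPartition_cells hb.1, hb.refines,
    (hPart_cells ν S b).symm⟩
  rintro _ ⟨α, hα, -, rfl⟩
  obtain ⟨a, ha, -, hcells⟩ := exists_labelling_of_isMPartition hα
  rw [← hcells, hPart_cells]
  exact rate_nonneg ν hS ha

theorem exists_isSelector_rate_lt (hS : MeasurePreserving S ν ν) {U : Finset (Set X)}
    (hU : IsMCover U) {r : ℝ} (hr : hPlusC ν S U < r) :
    ∃ b, IsSelector U b ∧ rate ν S b < r := by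
  have : Nonempty X := nonempty_of_isProbabilityMeasure ν
  obtain ⟨b₀, hb₀⟩ := hU.exists_isSelector
  obtain ⟨_, ⟨α, hα, hαU, rfl⟩, hlt⟩ := exists_lt_of_csInf_lt
    (by exact ⟨_, cells b₀, isMPartition_cells hb₀.1, hb₀.refines, rfl⟩) hr
  obtain ⟨a, φ, ha, hcells, hsel⟩ := exists_selector_of_refines hα hαU
  refine ⟨_, hsel, (rate_comp_le ν hS ha φ).trans_lt ?_⟩
  rwa [← hPart_cells, hcells]

theorem subadditive_entCover_joinN (hS : MeasurePreserving S ν ν) {U : Finset (Set X)}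
    (hU : IsMCover U) : Subadditive fun n => entCover ν (joinN S U n) := by
  intro n k
  refine le_of_forall_pos_le_add fun ε hε => ?_
  obtain ⟨b, hb, hb'⟩ := exists_isSelector_shannon_lt ν (hU.joinN hS.measurable n)
    (lt_add_of_pos_right (entCover ν (joinN S U n)) (half_pos hε))
  obtain ⟨c, hc, hc'⟩ := exists_isSelector_shannon_lt ν (hU.joinN hS.measurable k)
    (lt_add_of_pos_right (entCover ν (joinN S U k)) (half_pos hε))
  have hcS := hc.1.right_comp (hS.iterate n).measurable
  have h1 : entCover ν (joinN S U (n + k)) ≤ shannon ν fun x => (b x, c (S^[n] x)) := by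
    refine entCover_le_shannon ν (hb.1.prodMk hcS) fun ⟨u, v⟩ => ?_
    obtain ⟨s, hs, hsu⟩ := mem_joinN.1 u.2
    obtain ⟨t, ht, htv⟩ := mem_joinN.1 v.2
    refine ⟨_, mem_joinN.2 ⟨fun i => if i < n then s i else t (i - n), fun i hi => ?_, rfl⟩,
      fun x hx i hi => ?_⟩
    · by_cases h : i < n
      · simpa [h] using hs i h
      · simpa [h] using ht (i - n) (by omega)
    · obtain ⟨hx1, hx2⟩ := Prod.ext_iff.1 hx
      by_cases h : i < n
      · have : x ∈ (u : Set X) := hb.preimage_subset u hx1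
        rw [hsu] at this
        simpa [h] using this i h
      · have : S^[n] x ∈ (v : Set X) := hc.preimage_subset v hx2
        rw [htv] at this
        have h3 := this (i - n) (by omega)
        rw [← Function.iterate_add_apply, Nat.sub_add_cancel (by omega)] at h3
        simpa [h] using h3
  have h2 := shannon_prod_le ν hb.1 hcS
  have h3 := shannon_comp_measurePreserving ν (hS.iterate n) hc.1
  simp only
  linarith

theorem tendsto_hMinusC (hS : MeasurePreserving S ν ν) {U : Finset (Set X)} (hU : IsMCover U) :
    Tendsto (fun n : ℕ => entCover ν (joinN S U n) / n) atTop (𝓝 (hMinusC ν S U)) :=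
  tendsto_nhds_limUnder ⟨_, (subadditive_entCover_joinN ν hS hU).tendsto_lim
    ⟨0, by rintro _ ⟨n, rfl⟩; exact div_nonneg (entCover_nonneg ν) n.cast_nonneg⟩⟩

theorem entCover_joinN_mul_le (hS : Measurable S) {U : Finset (Set X)} {n : ℕ} (hn : 0 < n)
    {b : X → joinN S U n} (hb : IsSelector (joinN S U n) b) (N : ℕ) :
    entCover ν (joinN S U (n * N)) ≤ shannon ν (itin (S^[n]) b N) := by
  refine entCover_le_shannon ν (hb.1.itin (hS.iterate n) N) fun w => ?_
  choose s hs hsw using fun k : Fin N => mem_joinN.1 (w k).2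
  have hlt : ∀ i < n * N, i / n < N := fun i hi => Nat.div_lt_of_lt_mul hi
  refine ⟨_, mem_joinN.2 ⟨fun i => if h : i / n < N then s ⟨i / n, h⟩ (i % n) else ∅,
    fun i hi => ?_, rfl⟩, fun x hx i hi => ?_⟩
  · simp only [hlt i hi, dif_pos]
    exact hs _ _ (Nat.mod_lt _ hn)
  · simp only [hlt i hi, dif_pos]
    have h1 : b ((S^[n])^[i / n] x) = w ⟨i / n, hlt i hi⟩ := congrFun hx ⟨i / n, hlt i hi⟩
    have h2 := hb.preimage_subset _ h1
    rw [hsw] at h2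
    have h3 := h2 (i % n) (Nat.mod_lt _ hn)
    rwa [← Function.iterate_mul, ← Function.iterate_add_apply, Nat.mod_add_div] at h3

theorem IsSelector.hMinusC_le (hS : MeasurePreserving S ν ν) {U : Finset (Set X)}
    (hU : IsMCover U) {n : ℕ} (hn : 0 < n) {b : X → joinN S U n}
    (hb : IsSelector (joinN S U n) b) : hMinusC ν S U ≤ rate ν (S^[n]) b / n := by
  have h1 : Tendsto (fun N : ℕ => n * N) atTop atTop :=
    tendsto_id.const_mul_atTop' hn
  refine le_of_tendsto_of_tendsto' ((tendsto_hMinusC ν hS hU).comp h1)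
    ((tendsto_rate ν (hS.iterate n) hb.1).div_const (n : ℝ)) fun N => ?_
  simp only [Function.comp]
  rw [div_div, mul_comm (N : ℝ)]
  push_cast
  gcongr
  exact entCover_joinN_mul_le ν hS.measurable hn hb N

end CoverEntropy

section DenseSelectors

/-- A sequence of selectors that approximates every selector for every probability measure. -/
def DenseSelectors (U : Finset (Set X)) (B : ℕ → X → U) : Prop :=
  (∀ k, IsSelector U (B k)) ∧
    ∀ (ν : Measure X) [IsProbabilityMeasure ν] (b : X → U), IsSelector U b →
      ∀ δ > 0, ∃ k, ν.real {x | b x ≠ B k x} < δ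

theorem exists_dense_selectors [StandardBorelSpace X] [Nonempty X] {U : Finset (Set X)}
    (hU : IsMCover U) : ∃ B : ℕ → X → U, DenseSelectors U B := by
  have := hU.nonempty
  set 𝒜 : Set (Set X) := generateSetAlgebra (MeasurableSpace.countableGeneratingSet X) with h𝒜
  have hc : 𝒜.Countable :=
    countable_generateSetAlgebra (MeasurableSpace.countable_countableGeneratingSet (α := X))
  have hgen : ‹MeasurableSpace X› = MeasurableSpace.generateFrom 𝒜 := by
    rw [h𝒜, generateFrom_generateSetAlgebra_eq,
      MeasurableSpace.generateFrom_countableGeneratingSet]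
  have hmeas : ∀ t ∈ 𝒜, MeasurableSet t := fun t ht => by
    rw [hgen]; exact MeasurableSpace.measurableSet_generateFrom ht
  have : Countable 𝒜 := hc.to_subtype
  have : Nonempty 𝒜 := ⟨⟨∅, isSetAlgebra_generateSetAlgebra.empty_mem⟩⟩
  obtain ⟨e, he⟩ := exists_surjective_nat (U → 𝒜)
  refine ⟨fun k => selectorOf U fun u => (e k u : Set X),
    fun k => isSelector_selectorOf hU fun u => hmeas _ (e k u).2, fun ν _ b hb δ hδ => ?_⟩
  have hdense := Measure.MeasureDense.of_generateFrom_isSetAlgebra_finite (μ := ν)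
    (𝒜 := 𝒜) isSetAlgebra_generateSetAlgebra hgen
  obtain ⟨N, hN⟩ : ∃ N : ℝ, N = (Fintype.card U : ℝ) := ⟨_, rfl⟩
  have hNpos : 0 < N := by
    rw [hN]; exact_mod_cast Fintype.card_pos
  have happ : ∀ u : U, ∃ t : 𝒜, ν.real (symmDiff (b ⁻¹' {u}) t) < δ / N := fun u => by
    obtain ⟨t, ht, hlt⟩ := hdense.approx (b ⁻¹' {u}) (hb.1 _) (measure_ne_top _ _) (δ / N)
      (by positivity)
    refine ⟨⟨t, ht⟩, ?_⟩
    rw [Measure.real, ← ENNReal.lt_ofReal_iff_toReal_lt (measure_ne_top _ _)]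
    exact hlt
  choose t ht using happ
  obtain ⟨k, hk⟩ := he t
  refine ⟨k, ?_⟩
  have hsub : {x | b x ≠ selectorOf U (fun u => (e k u : Set X)) x} ⊆
      ⋃ u, symmDiff (b ⁻¹' {u}) (t u : Set X) := by
    intro x hx
    by_contra hnot
    apply hx
    simp only [Set.mem_iUnion, not_exists, Set.mem_symmDiff, not_or, not_and, not_not,
      Set.mem_preimage, Set.mem_singleton_iff] at hnot
    refine (patternLabel_eq (hb.2 x) fun v => ?_).symm
    rw [hk]
    exact ⟨fun h => ((hnot v).2 h).symm, fun h => (hnot v).1 h.symm⟩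
  calc _ ≤ ν.real (⋃ u, symmDiff (b ⁻¹' {u}) (t u : Set X)) := measureReal_mono hsub
    _ ≤ ∑ u, ν.real (symmDiff (b ⁻¹' {u}) (t u : Set X)) := measureReal_iUnion_fintype_le _
    _ < ∑ _u : U, δ / N := Finset.sum_lt_sum_of_nonempty Finset.univ_nonempty fun u _ => ht u
    _ = δ := by
      simp only [Finset.sum_const, Finset.card_univ, nsmul_eq_mul]
      rw [← hN]
      field_simp

variable (ν : Measure X) [IsProbabilityMeasure ν] {U : Finset (Set X)} {B : ℕ → X → U}

theorem DenseSelectors.entCover_eq (hB : DenseSelectors U B) (hU : IsMCover U) :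
    entCover ν U = ⨅ k, shannon ν (B k) := by
  refine le_antisymm (le_ciInf fun k => (hB.1 k).entCover_le ν) ?_
  refine le_of_forall_pos_le_add fun ε hε => ?_
  obtain ⟨b, hb, hlt⟩ := exists_isSelector_shannon_lt ν hU
    (lt_add_of_pos_right (entCover ν U) (half_pos hε))
  obtain ⟨δ, hδ, H⟩ := exists_shannon_correction_le (X := X) U (half_pos hε)
  obtain ⟨k, hk⟩ := hB.2 ν b hb δ hδ
  have h1 := H ν (B k) b (hB.1 k).1 hb.1 (by simpa only [ne_comm] using hk)
  have h2 := shannon_le_add_correction ν (hB.1 k).1 hb.1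
  have h3 : ⨅ k, shannon ν (B k) ≤ shannon ν (B k) :=
    ciInf_le ⟨0, by rintro _ ⟨k, rfl⟩; exact shannon_nonneg ν _⟩ k
  linarith

theorem DenseSelectors.hPlusC_eq (hB : DenseSelectors U B) (hU : IsMCover U) {S : X → X}
    (hS : MeasurePreserving S ν ν) : hPlusC ν S U = ⨅ k, rate ν S (B k) := by
  refine le_antisymm (le_ciInf fun k => (hB.1 k).hPlusC_le ν hS) ?_
  refine le_of_forall_pos_le_add fun ε hε => ?_
  obtain ⟨b, hb, hlt⟩ := exists_isSelector_rate_lt ν hS hU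
    (lt_add_of_pos_right (hPlusC ν S U) (half_pos hε))
  obtain ⟨δ, hδ, H⟩ := exists_shannon_correction_le (X := X) U (half_pos hε)
  obtain ⟨k, hk⟩ := hB.2 ν b hb δ hδ
  have h1 := H ν (B k) b (hB.1 k).1 hb.1 (by simpa only [ne_comm] using hk)
  have h2 := rate_le_add_correction ν hS (hB.1 k).1 hb.1
  have h3 : ⨅ k, rate ν S (B k) ≤ rate ν S (B k) :=
    ciInf_le ⟨0, by rintro _ ⟨k, rfl⟩; exact rate_nonneg ν hS (hB.1 k).1⟩ k
  linarith

end DenseSelectors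

section Mixture

variable {ι K Ω : Type*} [Fintype ι] [MeasurableSpace Ω] {m : Ω → Measure X}
  {a : X → ι}

theorem measurable_measureReal (hm : Measurable m) {s : Set X} (hs : MeasurableSet s) :
    Measurable fun ω => (m ω).real s :=
  ((Measure.measurable_coe hs).comp hm).ennreal_toReal

theorem measurable_shannon (hm : Measurable m) (ha : DiscMeas a) :
    Measurable fun ω => shannon (m ω) a :=
  Finset.measurable_sum _ fun i _ =>
    Real.continuous_negMulLog.measurable.comp (measurable_measureReal hm (ha {i}))

theorem measurable_rate [∀ ω, IsProbabilityMeasure (m ω)] (hm : Measurable m) {S : X → X}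
    (hS : ∀ ω, MeasurePreserving S (m ω) (m ω)) (ha : DiscMeas a) :
    Measurable fun ω => rate (m ω) S a := by
  rcases isEmpty_or_nonempty Ω with h | ⟨⟨ω₀⟩⟩
  · exact measurable_of_empty _
  · simp_rw [fun ω => rate_eq_iInf (m ω) (hS ω) ha]
    exact Measurable.iInf fun n =>
      (measurable_shannon hm (ha.itin (hS ω₀).measurable (n + 1))).div_const _

theorem sum_measureReal_preimage (ha : DiscMeas a) (ν : Measure X) [IsProbabilityMeasure ν] :
    ∑ i, ν.real (a ⁻¹' {i}) = 1 := by
  have := measureReal_preimage_eq_sum ν ha Set.univ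
  simpa using this.symm

variable (P : Measure Ω)

theorem measurePreserving_bind (hm : Measurable m) {S : X → X} (hS' : Measurable S)
    (hS : ∀ ω, MeasurePreserving S (m ω) (m ω)) :
    MeasurePreserving S (P.bind m) (P.bind m) := by
  refine ⟨hS', Measure.ext fun s hs => ?_⟩
  rw [Measure.map_apply hS' hs, Measure.bind_apply (hS' hs) hm.aemeasurable,
    Measure.bind_apply hs hm.aemeasurable]
  exact lintegral_congr fun ω => (hS ω).measure_preimage hs.nullMeasurableSet

theorem setIntegral_eq_mul_of_conditional {κ : Ω → K} {Q : K → Measure Ω}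
    (hQ : ∀ k, P.restrict (κ ⁻¹' {k}) = P (κ ⁻¹' {k}) • Q k) (f : Ω → ℝ) (k : K) :
    ∫ ω in κ ⁻¹' {k}, f ω ∂P = P.real (κ ⁻¹' {k}) * ∫ ω, f ω ∂(Q k) := by
  rw [hQ, integral_smul_measure]; rfl

variable [Fintype K]

theorem integral_eq_sum_setIntegral {κ : Ω → K} (hκ : DiscMeas κ) {f : Ω → ℝ}
    (hf : Integrable f P) : ∫ ω, f ω ∂P = ∑ k, ∫ ω in κ ⁻¹' {k}, f ω ∂P := by
  rw [← integral_iUnion_fintype (fun k => hκ {k}) ?_ fun k => hf.integrableOn]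
  · have : ⋃ k, κ ⁻¹' {k} = Set.univ := by ext; simp
    rw [this, setIntegral_univ]
  · intro i j hij
    exact Disjoint.preimage _ (by simpa using hij)

theorem measureReal_bind [∀ ω, IsProbabilityMeasure (m ω)] (hm : Measurable m) {s : Set X}
    (hs : MeasurableSet s) :
    (P.bind m).real s = ∫ ω, (m ω).real s ∂P := by
  simp only [Measure.real]
  rw [integral_toReal (f := fun ω => m ω s) ((Measure.measurable_coe hs).comp hm).aemeasurable
    (ae_of_all _ fun ω => measure_lt_top (m ω) s), Measure.bind_apply hs hm.aemeasurable]

variable [IsProbabilityMeasure P]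

theorem integrable_of_nonneg_of_le {f : Ω → ℝ} (hf : Measurable f) (C : ℝ) (h0 : ∀ ω, 0 ≤ f ω)
    (hC : ∀ ω, f ω ≤ C) : Integrable f P :=
  .of_bound hf.aestronglyMeasurable C (ae_of_all _ fun ω => by
    rw [Real.norm_of_nonneg (h0 ω)]; exact hC ω)

variable [∀ ω, IsProbabilityMeasure (m ω)]

theorem integrable_measureReal (hm : Measurable m) {s : Set X} (hs : MeasurableSet s) :
    Integrable (fun ω => (m ω).real s) P :=
  integrable_of_nonneg_of_le P (measurable_measureReal hm hs) 1 (fun _ => measureReal_nonneg)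
    fun _ => measureReal_le_one

theorem integrable_shannon (hm : Measurable m) (ha : DiscMeas a) :
    Integrable (fun ω => shannon (m ω) a) P :=
  integrable_of_nonneg_of_le P (measurable_shannon hm ha) _ (fun ω => shannon_nonneg (m ω) a)
    fun ω => shannon_le_card (m ω) a

theorem integrable_rate (hm : Measurable m) {S : X → X}
    (hS : ∀ ω, MeasurePreserving S (m ω) (m ω)) (ha : DiscMeas a) :
    Integrable (fun ω => rate (m ω) S a) P :=
  integrable_of_nonneg_of_le P (measurable_rate hm hS ha) _
    (fun ω => rate_nonneg (m ω) (hS ω) ha)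
    fun ω => (rate_le_shannon (m ω) (hS ω) ha).trans (shannon_le_card (m ω) a)

theorem isProbabilityMeasure_bind_of_forall (hm : Measurable m) :
    IsProbabilityMeasure (P.bind m) :=
  isProbabilityMeasure_bind hm.aemeasurable (ae_of_all _ inferInstance)

theorem integral_shannon_le (hm : Measurable m) (ha : DiscMeas a) :
    ∫ ω, shannon (m ω) a ∂P ≤ shannon (P.bind m) a := by
  have h_int : ∀ i, Integrable (fun ω => Real.negMulLog ((m ω).real (a ⁻¹' {i}))) P := fun i =>
    integrable_of_nonneg_of_le P
      (Real.continuous_negMulLog.measurable.comp (measurable_measureReal hm (ha {i}))) 1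
      (fun ω => Real.negMulLog_nonneg measureReal_nonneg measureReal_le_one) fun ω => by
        have h0 : 0 ≤ (m ω).real (a ⁻¹' {i}) := measureReal_nonneg
        linarith [Real.negMulLog_le_one_sub_self h0]
  simp only [shannon]
  rw [integral_finsetSum _ fun i _ => h_int i]
  refine Finset.sum_le_sum fun i _ => ?_
  rw [measureReal_bind P hm (ha {i})]
  exact Real.concaveOn_negMulLog.le_map_integral Real.continuous_negMulLog.continuousOn isClosed_Ici
    (ae_of_all _ fun ω => Set.mem_Ici.2 measureReal_nonneg)
    (integrable_measureReal P hm (ha {i})) (h_int i)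

/-- Conditional measures on the cells of `κ`, with an arbitrary choice on null cells. -/
theorem exists_conditional {K : Type*} (κ : Ω → K) :
    ∃ Q : K → Measure Ω, (∀ k, IsProbabilityMeasure (Q k)) ∧
      ∀ k, P.restrict (κ ⁻¹' {k}) = P (κ ⁻¹' {k}) • Q k := by
  refine ⟨fun k => if P (κ ⁻¹' {k}) = 0 then P else ProbabilityTheory.cond P (κ ⁻¹' {k}), fun k => ?_,
    fun k => ?_⟩
  · dsimp only
    split_ifs with h
    · infer_instance
    · exact ProbabilityTheory.cond_isProbabilityMeasure h
  · dsimp only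
    split_ifs with h
    · rw [h, zero_smul, Measure.restrict_eq_zero, h]
    · rw [ProbabilityTheory.cond, smul_smul, ENNReal.mul_inv_cancel h (measure_ne_top _ _),
        one_smul]

theorem shannon_bind_le (hm : Measurable m) (ha : DiscMeas a) {κ : Ω → K} (hκ : DiscMeas κ)
    {Q : K → Measure Ω} [∀ k, IsProbabilityMeasure (Q k)]
    (hQ : ∀ k, P.restrict (κ ⁻¹' {k}) = P (κ ⁻¹' {k}) • Q k) :
    shannon (P.bind m) a ≤
      ∑ k, P.real (κ ⁻¹' {k}) * shannon ((Q k).bind m) a + shannon P κ := by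
  have hprob := fun k => isProbabilityMeasure_bind_of_forall (Q k) hm
  set p : K → ℝ := fun k => P.real (κ ⁻¹' {k}) with hp
  set q : K → ι → ℝ := fun k i => ((Q k).bind m).real (a ⁻¹' {i}) with hq
  have hmix : ∀ i, (P.bind m).real (a ⁻¹' {i}) = ∑ k, p k * q k i := fun i => by
    rw [measureReal_bind P hm (ha {i}),
      integral_eq_sum_setIntegral P hκ (integrable_measureReal P hm (ha {i}))]
    refine Finset.sum_congr rfl fun k _ => ?_
    rw [setIntegral_eq_mul_of_conditional P hQ, hq]
    simp only
    rw [measureReal_bind (Q k) hm (ha {i})]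
  calc shannon (P.bind m) a = ∑ i, Real.negMulLog (∑ k, p k * q k i) :=
        Finset.sum_congr rfl fun i _ => by rw [hmix]
    _ ≤ ∑ i, ∑ k, Real.negMulLog (p k * q k i) := Finset.sum_le_sum fun i _ =>
        Real.negMulLog_sum_le _ _ fun k _ => mul_nonneg measureReal_nonneg measureReal_nonneg
    _ = ∑ k, ∑ i, (q k i * Real.negMulLog (p k) + p k * Real.negMulLog (q k i)) := by
        rw [Finset.sum_comm]; simp only [Real.negMulLog_mul]
    _ = ∑ k, (Real.negMulLog (p k) + p k * shannon ((Q k).bind m) a) := by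
        refine Finset.sum_congr rfl fun k _ => ?_
        rw [Finset.sum_add_distrib, ← Finset.sum_mul, ← Finset.mul_sum,
          sum_measureReal_preimage ha ((Q k).bind m), one_mul]
        rfl
    _ = _ := by rw [Finset.sum_add_distrib, add_comm]; rfl

theorem rate_bind_le (hm : Measurable m) {S : X → X} (hS' : Measurable S)
    (hS : ∀ ω, MeasurePreserving S (m ω) (m ω)) (ha : DiscMeas a) {κ : Ω → K}
    (hκ : DiscMeas κ) {Q : K → Measure Ω} [∀ k, IsProbabilityMeasure (Q k)]
    (hQ : ∀ k, P.restrict (κ ⁻¹' {k}) = P (κ ⁻¹' {k}) • Q k) :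
    rate (P.bind m) S a ≤ ∑ k, P.real (κ ⁻¹' {k}) * rate ((Q k).bind m) S a := by
  have := isProbabilityMeasure_bind_of_forall P hm
  have hprob := fun k => isProbabilityMeasure_bind_of_forall (Q k) hm
  have hlim : Tendsto (fun n : ℕ => ∑ k, P.real (κ ⁻¹' {k}) *
      (shannon ((Q k).bind m) (itin S a n) / n) + shannon P κ / n) atTop
      (𝓝 (∑ k, P.real (κ ⁻¹' {k}) * rate ((Q k).bind m) S a + 0)) :=
    (tendsto_finsetSum _ fun k _ => (tendsto_rate ((Q k).bind m)
      (measurePreserving_bind (Q k) hm hS' hS) ha).const_mul _).add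
        (tendsto_const_nhds.div_atTop tendsto_natCast_atTop_atTop)
  rw [add_zero] at hlim
  refine le_of_tendsto_of_tendsto'
    (tendsto_rate (P.bind m) (measurePreserving_bind P hm hS' hS) ha) hlim fun n => ?_
  have h := shannon_bind_le P hm (ha.itin hS' n) hκ hQ
  calc shannon (P.bind m) (itin S a n) / n
      ≤ (∑ k, P.real (κ ⁻¹' {k}) * shannon ((Q k).bind m) (itin S a n) + shannon P κ) / n := by
        gcongr
    _ = _ := by rw [add_div, Finset.sum_div]; simp only [mul_div_assoc]

/-- The cell measures of a labelling can be discretised so that each cell of the parameter space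
has almost constant entropy. -/
theorem exists_discretisation (hm : Measurable m) (ha : DiscMeas a) {ε : ℝ} (hε : 0 < ε) :
    ∃ (M : ℕ) (κ : Ω → ι → Fin (M + 1)), DiscMeas κ ∧
      ∀ (Q : Measure Ω) [IsProbabilityMeasure Q] (ω : Ω),
        (∀ᵐ ω' ∂Q, κ ω' = κ ω) → shannon (Q.bind m) a ≤ shannon (m ω) a + ε := by
  have huc : UniformContinuousOn Real.negMulLog (Set.Icc 0 1) :=
    isCompact_Icc.uniformContinuousOn_of_continuous Real.continuous_negMulLog.continuousOn
  rw [Metric.uniformContinuousOn_iff] at huc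
  obtain ⟨δ, hδ, H⟩ := huc (ε / (Fintype.card ι + 1)) (by positivity)
  obtain ⟨M, hM⟩ := exists_nat_gt (1 / δ)
  have hM0 : (0 : ℝ) < M := (by positivity : 0 < 1 / δ).trans hM
  have hM1 : 1 / (M : ℝ) < δ := by
    rw [div_lt_iff₀ hM0, mul_comm]; rwa [div_lt_iff₀ hδ] at hM
  refine ⟨M, fun ω i => ⟨min ⌊(m ω).real (a ⁻¹' {i}) * M⌋₊ M, by omega⟩, .pi fun i => ?_,
    fun Q _ ω hω => ?_⟩
  · refine .of_singleton fun j => ?_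
    have hmeas : Measurable fun ω => ⌊(m ω).real (a ⁻¹' {i}) * M⌋₊ :=
      Nat.measurable_floor.comp ((measurable_measureReal hm (ha {i})).mul_const _)
    have : (fun ω => (⟨min ⌊(m ω).real (a ⁻¹' {i}) * M⌋₊ M, by omega⟩ : Fin (M + 1))) ⁻¹' {j}
        = (fun ω => ⌊(m ω).real (a ⁻¹' {i}) * M⌋₊) ⁻¹' {l | min l M = j} := by
      ext ω; simp [Fin.ext_iff]
    rw [this]
    exact hmeas (MeasurableSet.of_discrete)
  · have hclose : ∀ i, |((Q.bind m).real (a ⁻¹' {i})) - (m ω).real (a ⁻¹' {i})| < δ := by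
      intro i
      have hae : ∀ᵐ ω' ∂Q, ‖(m ω').real (a ⁻¹' {i}) - (m ω).real (a ⁻¹' {i})‖ ≤ 1 / M := by
        filter_upwards [hω] with ω' h
        have h1 := congrArg Fin.val (congrFun h i)
        have hle : ∀ ω, ⌊(m ω).real (a ⁻¹' {i}) * M⌋₊ ≤ M := fun ω => by
          refine Nat.floor_le_of_le ?_
          have : (m ω).real (a ⁻¹' {i}) ≤ 1 := measureReal_le_one
          nlinarith
        simp only [min_eq_left (hle _)] at h1
        have hf : ∀ ω, 0 ≤ (m ω).real (a ⁻¹' {i}) * M := fun ω => by positivity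
        have h2 := Nat.floor_le (hf ω)
        have h3 := Nat.lt_floor_add_one ((m ω).real (a ⁻¹' {i}) * M)
        have h4 := Nat.floor_le (hf ω')
        have h5 := Nat.lt_floor_add_one ((m ω').real (a ⁻¹' {i}) * M)
        rw [h1] at h4 h5
        have h6 : |((m ω').real (a ⁻¹' {i}) - (m ω).real (a ⁻¹' {i})) * M| ≤ 1 := by
          rw [sub_mul, abs_le]
          constructor <;> linarith
        rwa [abs_mul, abs_of_pos hM0, ← le_div_iff₀ hM0] at h6
      have h := norm_integral_le_of_norm_le_const hae
      rw [integral_sub (integrable_measureReal Q hm (ha {i})) (integrable_const _),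
        ← measureReal_bind Q hm (ha {i})] at h
      simp only [integral_const, probReal_univ, mul_one, smul_eq_mul, one_mul] at h
      exact (Real.norm_eq_abs _ ▸ h).trans_lt hM1
    have := isProbabilityMeasure_bind_of_forall Q hm
    have hterm : ∀ i, Real.negMulLog ((Q.bind m).real (a ⁻¹' {i})) ≤
        Real.negMulLog ((m ω).real (a ⁻¹' {i})) + ε / (Fintype.card ι + 1) := fun i => by
      have h := H _ ⟨measureReal_nonneg, measureReal_le_one⟩ _
        ⟨measureReal_nonneg, measureReal_le_one⟩ (hclose i)
      rw [Real.dist_eq] at h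
      linarith [(abs_lt.1 h).2]
    calc shannon (Q.bind m) a
        ≤ ∑ i, (Real.negMulLog ((m ω).real (a ⁻¹' {i})) + ε / (Fintype.card ι + 1)) :=
          Finset.sum_le_sum fun i _ => hterm i
      _ = shannon (m ω) a + Fintype.card ι * (ε / (Fintype.card ι + 1)) := by
          rw [Finset.sum_add_distrib, Finset.sum_const, Finset.card_univ, nsmul_eq_mul]; rfl
      _ ≤ shannon (m ω) a + ε := by
          gcongr
          rw [mul_div_assoc', div_le_iff₀ (by positivity)]
          nlinarith

theorem rate_bind_le_integral_shannon (hm : Measurable m) {S : X → X} (hS' : Measurable S)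
    (hS : ∀ ω, MeasurePreserving S (m ω) (m ω)) (ha : DiscMeas a) {n : ℕ} (hn : n ≠ 0) :
    rate (P.bind m) S a ≤ (∫ ω, shannon (m ω) (itin S a n) ∂P) / n := by
  refine le_of_forall_pos_le_add fun ε hε => ?_
  have hn' : (0 : ℝ) < n := by positivity
  have hb := ha.itin hS' n
  obtain ⟨M, κ, hκ, H⟩ := exists_discretisation hm hb (mul_pos hε hn')
  obtain ⟨Q, hQp, hQ⟩ := exists_conditional P κ
  have hprob := fun k => isProbabilityMeasure_bind_of_forall (Q k) hm
  have h_int : Integrable (fun ω => shannon (m ω) (itin S a n) + ε * n) P :=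
    (integrable_shannon P hm hb).add (integrable_const (ε * n))
  calc rate (P.bind m) S a ≤ ∑ k, P.real (κ ⁻¹' {k}) * rate ((Q k).bind m) S a :=
        rate_bind_le P hm hS' hS ha hκ hQ
    _ ≤ ∑ k, (∫ ω in κ ⁻¹' {k}, (shannon (m ω) (itin S a n) + ε * n) ∂P) / n := by
        refine Finset.sum_le_sum fun k _ => ?_
        rw [setIntegral_eq_mul_of_conditional P hQ, mul_div_assoc]
        rcases eq_or_ne (P (κ ⁻¹' {k})) 0 with h0 | h0
        · simp [Measure.real, h0]
        have hQk : ∀ᵐ ω ∂(Q k), κ ω = k := by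
          have h : ∀ᵐ ω ∂(P (κ ⁻¹' {k}) • Q k), κ ω = k := by
            rw [← hQ]; exact ae_restrict_mem (hκ {k})
          rwa [Measure.ae_ennreal_smul_measure_iff h0] at h
        refine mul_le_mul_of_nonneg_left ?_ measureReal_nonneg
        refine (rate_le_div _ (measurePreserving_bind (Q k) hm hS' hS) ha hn).trans ?_
        gcongr
        have hle : ∫ _ω, shannon ((Q k).bind m) (itin S a n) ∂(Q k) ≤
            ∫ ω, (shannon (m ω) (itin S a n) + ε * n) ∂(Q k) := by
          refine integral_mono_ae (integrable_const _)
            ((integrable_shannon (Q k) hm hb).add (integrable_const (ε * n))) ?_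
          filter_upwards [hQk] with ω hω
          exact H (Q k) ω (hQk.mono fun ω' h => h.trans hω.symm)
        simpa using hle
    _ = (∫ ω, shannon (m ω) (itin S a n) ∂P) / n + ε := by
        rw [← Finset.sum_div, ← integral_eq_sum_setIntegral P hκ h_int,
          integral_add (integrable_shannon P hm hb) (integrable_const _)]
        simp only [integral_const, probReal_univ, smul_eq_mul, one_mul]
        field_simp

theorem rate_bind_eq_integral (hm : Measurable m) {S : X → X} (hS' : Measurable S)
    (hS : ∀ ω, MeasurePreserving S (m ω) (m ω)) (ha : DiscMeas a) :
    rate (P.bind m) S a = ∫ ω, rate (m ω) S a ∂P := by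
  have := isProbabilityMeasure_bind_of_forall P hm
  have hlim : Tendsto (fun n : ℕ => (∫ ω, shannon (m ω) (itin S a n) ∂P) / n) atTop
      (𝓝 (∫ ω, rate (m ω) S a ∂P)) := by
    simp_rw [← integral_div]
    refine tendsto_integral_of_dominated_convergence (fun _ => (Fintype.card ι : ℝ))
      (fun n => ((measurable_shannon hm (ha.itin hS' n)).div_const _).aestronglyMeasurable)
      (integrable_const _) (fun n => ae_of_all _ fun ω => ?_)
      (ae_of_all _ fun ω => tendsto_rate (m ω) (hS ω) ha)
    rw [Real.norm_of_nonneg (div_nonneg (shannon_nonneg _ _) n.cast_nonneg)]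
    exact (shannon_itin_div_le (m ω) (hS ω) ha n).trans (shannon_le_card _ _)
  refine le_antisymm (ge_of_tendsto hlim ?_) (le_of_tendsto_of_tendsto' hlim
    (tendsto_rate (P.bind m) (measurePreserving_bind P hm hS' hS) ha) fun n => ?_)
  · filter_upwards [eventually_ne_atTop 0] with n hn
    exact rate_bind_le_integral_shannon P hm hS' hS ha hn
  · gcongr
    exact integral_shannon_le P hm (ha.itin hS' n)

end Mixture

section MeanErgodic

variable (ν : Measure X) {S : X → X} {g : X → ℝ}

theorem memLp_birkhoffSum (hS : MeasurePreserving S ν ν) (hg : MemLp g 2 ν) (n : ℕ) :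
    MemLp (birkhoffSum S g n) 2 ν := by
  induction n with
  | zero => rw [birkhoffSum_zero']; exact .zero
  | succ n ih =>
    have : birkhoffSum S g (n + 1) = birkhoffSum S g n + g ∘ S^[n] :=
      funext fun x => birkhoffSum_succ S g n x
    rw [this]
    exact ih.add (hg.comp_measurePreserving (hS.iterate n))

theorem memLp_birkhoffAverage (hS : MeasurePreserving S ν ν) (hg : MemLp g 2 ν) (n : ℕ) :
    MemLp (birkhoffAverage ℝ S g n) 2 ν :=
  (memLp_birkhoffSum ν hS hg n).const_smul (n : ℝ)⁻¹

theorem birkhoffSum_toLp (hS : MeasurePreserving S ν ν) (hg : MemLp g 2 ν) (n : ℕ) :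
    birkhoffSum (Lp.compMeasurePreserving S hS) id n (hg.toLp g) =
      (memLp_birkhoffSum ν hS hg n).toLp _ := by
  induction n with
  | zero =>
    rw [birkhoffSum_zero, eq_comm, Lp.eq_zero_iff_ae_eq_zero]
    refine (MemLp.coeFn_toLp _).trans ?_
    rw [birkhoffSum_zero']
  | succ n ih =>
    rw [birkhoffSum_succ, ih, Lp.compMeasurePreserving_iterate, id,
      Lp.toLp_compMeasurePreserving, ← MemLp.toLp_add]
    refine MemLp.toLp_congr _ _ (ae_of_all _ fun x => ?_)
    rw [birkhoffSum_succ]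
    rfl

theorem birkhoffAverage_toLp (hS : MeasurePreserving S ν ν) (hg : MemLp g 2 ν) (n : ℕ) :
    birkhoffAverage ℝ (Lp.compMeasurePreserving S hS) id n (hg.toLp g) =
      (memLp_birkhoffAverage ν hS hg n).toLp _ := by
  rw [birkhoffAverage, birkhoffSum_toLp ν hS hg n, ← MemLp.toLp_const_smul]
  rfl

theorem integral_birkhoffAverage [IsFiniteMeasure ν] (hS : MeasurePreserving S ν ν)
    (hg : Integrable g ν) {n : ℕ} (hn : n ≠ 0) : ∫ x, birkhoffAverage ℝ S g n x ∂ν = ∫ x, g x ∂ν := by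
  have hn' : (n : ℝ) ≠ 0 := by exact_mod_cast hn
  have hcomp : ∀ i, ∫ x, g (S^[i] x) ∂ν = ∫ x, g x ∂ν := fun i => by
    have h := hS.iterate i
    rw [← integral_map h.measurable.aemeasurable (by rw [h.map_eq]; exact hg.1), h.map_eq]
  simp only [birkhoffAverage, birkhoffSum, smul_eq_mul]
  rw [integral_const_mul, integral_finsetSum _ fun i _ => show Integrable (fun x => g (S^[i] x)) ν from
    (hS.iterate i).integrable_comp_of_integrable hg]
  simp only [hcomp, Finset.sum_const, Finset.card_range, nsmul_eq_mul]
  field_simp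

/-- Mean ergodic theorem for an ergodic transformation. -/
theorem tendsto_eLpNorm_birkhoffAverage [IsProbabilityMeasure ν] (hS : Ergodic S ν)
    (hg : MemLp g 2 ν) :
    Tendsto (fun n => eLpNorm (birkhoffAverage ℝ S g n - fun _ => ∫ x, g x ∂ν) 1 ν) atTop
      (𝓝 0) := by
  have hS' := hS.toMeasurePreserving
  set f : Lp ℝ 2 ν →L[ℝ] Lp ℝ 2 ν :=
    (Lp.compMeasurePreservingₗᵢ ℝ S hS').toContinuousLinearMap with hf
  have hlim := f.tendsto_birkhoffAverage_orthogonalProjection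
    (LinearIsometry.norm_toContinuousLinearMap_le _) (hg.toLp g)
  set y := (f.eqLocus (1 : Lp ℝ 2 ν →L[ℝ] Lp ℝ 2 ν)).orthogonalProjectionOnto (hg.toLp g)
  have hfix : f y = y := y.2
  obtain ⟨c, hc⟩ := hS.eq_const_of_compMeasurePreserving_eq (g := (y : Lp ℝ 2 ν).1)
    (congrArg Subtype.val hfix)
  have hyc : (y : Lp ℝ 2 ν) = (memLp_const c).toLp (fun _ => c) := by
    apply Subtype.ext
    rw [hc]; rfl
  rw [hyc] at hlim
  have hlim' : Tendsto (fun n => (memLp_birkhoffAverage ν hS' hg n).toLp _) atTop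
      (𝓝 ((memLp_const c).toLp (fun _ => c) : Lp ℝ 2 ν)) :=
    hlim.congr fun n => birkhoffAverage_toLp ν hS' hg n
  rw [Lp.tendsto_Lp_iff_tendsto_eLpNorm''] at hlim'
  have hL1 : Tendsto (fun n => eLpNorm (birkhoffAverage ℝ S g n - fun _ => c) 1 ν) atTop
      (𝓝 0) :=
    tendsto_of_tendsto_of_tendsto_of_le_of_le tendsto_const_nhds hlim' (fun _ => zero_le)
      fun n => eLpNorm_le_eLpNorm_of_exponent_le one_le_two
        ((memLp_birkhoffAverage ν hS' hg n).1.sub aestronglyMeasurable_const)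
  have h_int := fun n => (memLp_birkhoffAverage ν hS' hg n).integrable one_le_two
  have h := tendsto_integral_of_L1' (fun _ => c) (aestronglyMeasurable_const)
    (Eventually.of_forall h_int) hL1
  have hc' : ∫ x, g x ∂ν = c := by
    refine tendsto_nhds_unique (tendsto_const_nhds.congr' ?_) (by simpa using h)
    filter_upwards [eventually_ne_atTop 0] with n hn
    exact (integral_birkhoffAverage ν hS' (hg.integrable one_le_two) hn).symm
  rwa [hc']

end MeanErgodic

section Descends

variable {ι Ω : Type*} [MeasurableSpace Ω] {P : Measure Ω} {m : Ω → Measure X}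

/-- A function of the parameter `ω` descends to `X` if it can be read off, measurably, from
`m ω`-almost every point of `X`. -/
def Descends (P : Measure Ω) (m : Ω → Measure X) (g : Ω → ℝ) : Prop :=
  ∃ f : X → ℝ, Measurable f ∧ ∀ᵐ ω ∂P, ∀ᵐ y ∂(m ω), f y = g ω

theorem Descends.comp [Countable ι] {g : ι → Ω → ℝ} (h : ∀ i, Descends P m (g i))
    {φ : (ι → ℝ) → ℝ} (hφ : Measurable φ) : Descends P m fun ω => φ fun i => g i ω := by
  choose f hf hfg using h
  refine ⟨fun y => φ fun i => f i y, hφ.comp (measurable_pi_lambda _ hf), ?_⟩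
  filter_upwards [ae_all_iff.2 hfg] with ω hω
  filter_upwards [ae_all_iff.2 hω] with y hy
  exact congrArg φ (funext hy)

theorem birkhoffAverage_indicator_mem_Icc {X : Type*} (S : X → X) (s : Set X) (n : ℕ) (x : X) :
    birkhoffAverage ℝ S (s.indicator 1) n x ∈ Set.Icc (0 : ℝ) 1 := by
  have h0 : ∀ y, 0 ≤ s.indicator (1 : X → ℝ) y := fun y =>
    Set.indicator_nonneg (fun _ _ => zero_le_one) y
  have h1 : ∀ y, s.indicator (1 : X → ℝ) y ≤ 1 := fun y =>
    Set.indicator_le_self' (fun _ _ => zero_le_one) y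
  rw [birkhoffAverage, birkhoffSum, smul_eq_mul]
  refine ⟨mul_nonneg (by positivity) (Finset.sum_nonneg fun i _ => h0 _), ?_⟩
  rcases n.eq_zero_or_pos with rfl | hn
  · simp
  rw [inv_mul_le_iff₀ (by positivity)]
  simpa using Finset.sum_le_sum fun (i : ℕ) (_ : i ∈ Finset.range n) => h1 (S^[i] x)

variable [IsProbabilityMeasure P] [∀ ω, IsProbabilityMeasure (m ω)]

theorem descends_measureReal (hm : Measurable m) {S : X → X}
    (hS : ∀ ω, Ergodic S (m ω)) (hS' : Measurable S) {s : Set X} (hs : MeasurableSet s) :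
    Descends P m fun ω => (m ω).real s := by
  let κ : ProbabilityTheory.Kernel Ω X := ⟨m, hm⟩
  have : ProbabilityTheory.IsMarkovKernel κ := ⟨fun ω => inferInstanceAs (IsProbabilityMeasure (m ω))⟩
  set A : ℕ → X → ℝ := fun n => birkhoffAverage ℝ S (s.indicator 1) n with hA
  have hAm : ∀ n, Measurable (A n) := fun n => by
    have : A n = fun x => (n : ℝ)⁻¹ * ∑ i ∈ Finset.range n, s.indicator 1 (S^[i] x) := rfl
    rw [this]
    exact (Finset.measurable_sum _ fun i _ =>
      (measurable_one.indicator hs).comp (hS'.iterate i)).const_mul _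
  have hGm : Measurable fun p : Ω × X => (m p.1).real s :=
    (measurable_measureReal hm hs).comp measurable_fst
  have hdiff : ∀ n, Measurable fun p : Ω × X => A n p.2 - (m p.1).real s := fun n =>
    ((hAm n).comp measurable_snd).sub hGm
  have hnorm : ∀ n ω, eLpNorm (A n - fun _ => (m ω).real s) 1 (m ω) =
      ∫⁻ y, ‖A n y - (m ω).real s‖ₑ ∂(κ ω) := fun n ω => eLpNorm_one_eq_lintegral_enorm
  have hpt : ∀ ω, Tendsto (fun n => ∫⁻ y, ‖A n y - (m ω).real s‖ₑ ∂(κ ω)) atTop (𝓝 0) := by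
    intro ω
    have h := tendsto_eLpNorm_birkhoffAverage (m ω) (hS ω) (g := s.indicator 1)
      (memLp_indicator_const 2 hs (1 : ℝ) (.inr (measure_ne_top _ _)))
    rw [integral_indicator_one hs] at h
    exact h.congr fun n => hnorm n ω
  have hlim : Tendsto (fun n => eLpNorm ((fun p : Ω × X => A n p.2) - fun p => (m p.1).real s) 1
      (P.compProd κ)) atTop (𝓝 0) := by
    have heq : ∀ n, eLpNorm ((fun p : Ω × X => A n p.2) - fun p => (m p.1).real s) 1 (P.compProd κ) =
        ∫⁻ ω, ∫⁻ y, ‖A n y - (m ω).real s‖ₑ ∂(κ ω) ∂P := fun n => by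
      rw [eLpNorm_one_eq_lintegral_enorm]
      exact Measure.lintegral_compProd (hdiff n).enorm
    simp_rw [heq]
    rw [← lintegral_zero (μ := P)]
    refine tendsto_lintegral_of_dominated_convergence (fun _ => 1)
      (fun n => (hdiff n).enorm.lintegral_kernel_prod_right') (fun n => ae_of_all _ fun ω => ?_)
      (by simp) (ae_of_all _ hpt)
    refine (lintegral_mono (g := fun _ => 1) fun y => ?_).trans (by simp)
    obtain ⟨h1, h2⟩ := birkhoffAverage_indicator_mem_Icc S s n y
    have h3 : 0 ≤ (m ω).real s := measureReal_nonneg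
    have h4 : (m ω).real s ≤ 1 := measureReal_le_one
    rw [Real.enorm_eq_ofReal_abs]
    refine ENNReal.ofReal_le_one.2 (abs_le.2 ⟨?_, ?_⟩) <;> simp only [hA] <;> linarith
  obtain ⟨ns, -, hns⟩ := (tendstoInMeasure_of_tendsto_eLpNorm one_ne_zero
    (fun n => ((hAm n).comp measurable_snd).aestronglyMeasurable)
    hGm.aestronglyMeasurable hlim).exists_seq_tendsto_ae
  refine ⟨fun y => limsup (fun i => A (ns i) y) atTop, .limsup fun i => hAm (ns i), ?_⟩
  filter_upwards [Measure.ae_ae_of_ae_compProd hns] with ω hω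
  filter_upwards [hω] with y hy using hy.limsup_eq

theorem descends_shannon [Fintype ι] (hm : Measurable m) {S : X → X}
    (hS : ∀ ω, Ergodic S (m ω)) (hS' : Measurable S) {a : X → ι} (ha : DiscMeas a) :
    Descends P m fun ω => shannon (m ω) a :=
  Descends.comp (fun i => descends_measureReal hm hS hS' (ha {i}))
    (φ := fun v => ∑ i, Real.negMulLog (v i))
    (Finset.measurable_sum _ fun i _ =>
      Real.continuous_negMulLog.measurable.comp (measurable_pi_apply i))

theorem descends_rate [Fintype ι] (hm : Measurable m) {S : X → X}
    (hS : ∀ ω, Ergodic S (m ω)) (hS' : Measurable S) {a : X → ι} (ha : DiscMeas a) :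
    Descends P m fun ω => rate (m ω) S a := by
  simp_rw [fun ω => rate_eq_iInf (m ω) (hS ω).toMeasurePreserving ha]
  exact Descends.comp (fun n : ℕ => descends_shannon hm hS hS' (ha.itin hS' (n + 1)))
    (φ := fun v => ⨅ n : ℕ, v n / (n + 1 : ℕ))
    (.iInf fun n => (measurable_pi_apply n).div_const _)

end Descends

/-- Labellings that are nearly optimal for the different components `m ω` can be glued into a
single labelling. -/
theorem exists_glue {ι Ω : Type*} [MeasurableSpace Ω] {P : Measure Ω} {m : Ω → Measure X}
    {b : ℕ → X → ι} (hb : ∀ k, DiscMeas (b k)) {g : ℕ → Ω → ℝ}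
    (hg : ∀ k, Descends P m (g k)) {ε : ℝ} (hε : 0 < ε) :
    ∃ J : X → ℕ, DiscMeas (fun y => b (J y) y) ∧
      ∀ᵐ ω ∂P, ∃ k, (fun y => b (J y) y) =ᵐ[m ω] b k ∧ g k ω ≤ (⨅ j, g j ω) + ε := by
  choose f hf hfg using hg
  have hex : ∀ v : ℕ → ℝ, ∃ k, v k < (⨅ j, v j) + ε := fun v =>
    exists_lt_of_ciInf_lt (lt_add_of_pos_right _ hε)
  have hJ : Measurable fun y => Nat.find (hex fun k => f k y) :=
    measurable_find (fun y => hex fun k => f k y) fun k =>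
      measurableSet_lt (hf k) ((Measurable.iInf hf).add_const ε)
  refine ⟨fun y => Nat.find (hex fun k => f k y), fun s => ?_, ?_⟩
  · have : (fun y => b (Nat.find (hex fun k => f k y)) y) ⁻¹' s =
        ⋃ k, (fun y => Nat.find (hex fun k => f k y)) ⁻¹' {k} ∩ b k ⁻¹' s := by
      ext y; simp
    rw [this]
    exact .iUnion fun k => (hJ (measurableSet_singleton k)).inter (hb k s)
  · filter_upwards [ae_all_iff.2 hfg] with ω hω
    refine ⟨Nat.find (hex fun k => g k ω), ?_, (Nat.find_spec (hex fun k => g k ω)).le⟩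
    filter_upwards [ae_all_iff.2 hω] with y hy
    exact congrArg (fun v => b (Nat.find (hex v)) y) (funext hy : (fun k => f k y) = fun k => g k ω)

section ErgodicDecomposition

theorem entCover_joinN_div_le (ν : Measure X) [IsProbabilityMeasure ν] {S : X → X}
    (hS : MeasurePreserving S ν ν) {U : Finset (Set X)} (hU : IsMCover U) (n : ℕ) :
    entCover ν (joinN S U n) / n ≤ (joinN S U 1).card := by
  have : Nonempty X := nonempty_of_isProbabilityMeasure ν
  obtain ⟨b, hb⟩ := (hU.joinN hS.measurable 1).exists_isSelector
  have h1 := entCover_joinN_mul_le ν hS.measurable one_pos hb n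
  rw [one_mul, Function.iterate_one] at h1
  calc entCover ν (joinN S U n) / n ≤ shannon ν (itin S b n) / n := by gcongr
    _ ≤ shannon ν b := shannon_itin_div_le ν hS hb.1 n
    _ ≤ Fintype.card (joinN S U 1) := shannon_le_card ν b
    _ = (joinN S U 1).card := by simp

variable [StandardBorelSpace X] {Ω : Type*} [MeasurableSpace Ω] (P : Measure Ω)
  [IsProbabilityMeasure P] {m : Ω → Measure X} [∀ ω, IsProbabilityMeasure (m ω)]
  {U : Finset (Set X)}

theorem integrable_entCover (hm : Measurable m) (hU : IsMCover U) :
    Integrable (fun ω => entCover (m ω) U) P := by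
  have ⟨ω₀⟩ := nonempty_of_isProbabilityMeasure P
  have := nonempty_of_isProbabilityMeasure (m ω₀)
  obtain ⟨B, hB⟩ := exists_dense_selectors hU
  refine integrable_of_nonneg_of_le P ?_ U.card (fun ω => entCover_nonneg (m ω))
    fun ω => entCover_le_card (m ω) hU
  simp_rw [fun ω => hB.entCover_eq (m ω) hU]
  exact .iInf fun k => measurable_shannon hm (hB.1 k).1

theorem integral_entCover_le (hm : Measurable m) (hU : IsMCover U) :
    ∫ ω, entCover (m ω) U ∂P ≤ entCover (P.bind m) U := by
  have := isProbabilityMeasure_bind_of_forall P hm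
  refine le_of_forall_pos_le_add fun ε hε => ?_
  obtain ⟨b, hb, hlt⟩ := exists_isSelector_shannon_lt (P.bind m) hU
    (lt_add_of_pos_right (entCover (P.bind m) U) hε)
  calc ∫ ω, entCover (m ω) U ∂P ≤ ∫ ω, shannon (m ω) b ∂P :=
        integral_mono (integrable_entCover P hm hU) (integrable_shannon P hm hb.1)
          fun ω => hb.entCover_le (m ω)
    _ ≤ shannon (P.bind m) b := integral_shannon_le P hm hb.1
    _ ≤ _ := hlt.le

variable {S : X → X}

theorem integrable_hPlusC (hm : Measurable m) (hS : ∀ ω, MeasurePreserving S (m ω) (m ω))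
    (hU : IsMCover U) : Integrable (fun ω => hPlusC (m ω) S U) P := by
  have ⟨ω₀⟩ := nonempty_of_isProbabilityMeasure P
  have := nonempty_of_isProbabilityMeasure (m ω₀)
  obtain ⟨B, hB⟩ := exists_dense_selectors hU
  refine integrable_of_nonneg_of_le P ?_ (Fintype.card U) (fun ω => hPlusC_nonneg (m ω) (hS ω))
    fun ω => ((hB.1 0).hPlusC_le (m ω) (hS ω)).trans <|
      (rate_le_shannon (m ω) (hS ω) (hB.1 0).1).trans (shannon_le_card (m ω) _)
  simp_rw [fun ω => hB.hPlusC_eq (m ω) hU (hS ω)]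
  exact .iInf fun k => measurable_rate hm hS (hB.1 k).1

theorem tendsto_integral_entCover_joinN (hm : Measurable m)
    (hS : ∀ ω, MeasurePreserving S (m ω) (m ω)) (hU : IsMCover U) :
    Tendsto (fun n : ℕ => (∫ ω, entCover (m ω) (joinN S U n) ∂P) / n) atTop
      (𝓝 (∫ ω, hMinusC (m ω) S U ∂P)) := by
  have ⟨ω₀⟩ := nonempty_of_isProbabilityMeasure P
  simp_rw [← integral_div]
  refine tendsto_integral_of_dominated_convergence (fun _ => ((joinN S U 1).card : ℝ))
    (fun n => ((integrable_entCover P hm (hU.joinN (hS ω₀).measurable n)).div_const _).1)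
    (integrable_const _) (fun n => ae_of_all _ fun ω => ?_)
    (ae_of_all _ fun ω => tendsto_hMinusC (m ω) (hS ω) hU)
  rw [Real.norm_of_nonneg (div_nonneg (entCover_nonneg (m ω)) n.cast_nonneg)]
  exact entCover_joinN_div_le (m ω) (hS ω) hU n

theorem hPlusC_bind (hm : Measurable m) (hS : ∀ ω, Ergodic S (m ω)) (hU : IsMCover U) :
    hPlusC (P.bind m) S U = ∫ ω, hPlusC (m ω) S U ∂P := by
  have ⟨ω₀⟩ := nonempty_of_isProbabilityMeasure P
  have := nonempty_of_isProbabilityMeasure (m ω₀)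
  have := isProbabilityMeasure_bind_of_forall P hm
  have hS' := (hS ω₀).measurable
  have hmp := fun ω => (hS ω).toMeasurePreserving
  have hbind := measurePreserving_bind P hm hS' hmp
  refine le_antisymm (le_of_forall_pos_le_add fun ε hε => ?_)
    (le_of_forall_pos_le_add fun ε hε => ?_)
  · obtain ⟨B, hB⟩ := exists_dense_selectors hU
    obtain ⟨J, hJ, hopt⟩ := exists_glue (P := P) (fun k => (hB.1 k).1)
      (fun k => descends_rate hm hS hS' (hB.1 k).1) hε
    have hsel : IsSelector U fun y => B (J y) y := ⟨hJ, fun y => (hB.1 (J y)).2 y⟩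
    calc hPlusC (P.bind m) S U ≤ rate (P.bind m) S fun y => B (J y) y :=
          hsel.hPlusC_le _ hbind
      _ = ∫ ω, rate (m ω) S (fun y => B (J y) y) ∂P := rate_bind_eq_integral P hm hS' hmp hJ
      _ ≤ ∫ ω, (hPlusC (m ω) S U + ε) ∂P := by
          refine integral_mono_ae (integrable_rate P hm hmp hJ)
            ((integrable_hPlusC P hm hmp hU).add (integrable_const ε)) ?_
          filter_upwards [hopt] with ω ⟨k, hk, hle⟩
          rwa [rate_congr (m ω) (hmp ω) hk, hB.hPlusC_eq (m ω) hU (hmp ω)]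
      _ = ∫ ω, hPlusC (m ω) S U ∂P + ε := by
          rw [integral_add (integrable_hPlusC P hm hmp hU) (integrable_const ε)]
          simp
  · obtain ⟨b, hb, hlt⟩ := exists_isSelector_rate_lt (P.bind m) hbind hU
      (lt_add_of_pos_right (hPlusC (P.bind m) S U) hε)
    calc ∫ ω, hPlusC (m ω) S U ∂P ≤ ∫ ω, rate (m ω) S b ∂P :=
          integral_mono (integrable_hPlusC P hm hmp hU) (integrable_rate P hm hmp hb.1)
            fun ω => hb.hPlusC_le (m ω) (hmp ω)
      _ = rate (P.bind m) S b := (rate_bind_eq_integral P hm hS' hmp hb.1).symm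
      _ ≤ _ := hlt.le

theorem hMinusC_bind_le (hm : Measurable m) (hS : ∀ ω, Ergodic S (m ω)) (hU : IsMCover U)
    {n : ℕ} (hn : 0 < n) :
    hMinusC (P.bind m) S U ≤ (∫ ω, entCover (m ω) (joinN S U n) ∂P) / n := by
  have ⟨ω₀⟩ := nonempty_of_isProbabilityMeasure P
  have := nonempty_of_isProbabilityMeasure (m ω₀)
  have := isProbabilityMeasure_bind_of_forall P hm
  have hS' := (hS ω₀).measurable
  have hmp := fun ω => (hS ω).toMeasurePreserving
  have hmpn := fun ω => (hmp ω).iterate n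
  have hV := hU.joinN hS' n
  have hn' : (0 : ℝ) < n := by positivity
  refine le_of_forall_pos_le_add fun ε hε => ?_
  obtain ⟨B, hB⟩ := exists_dense_selectors hV
  obtain ⟨J, hJ, hopt⟩ := exists_glue (P := P) (fun k => (hB.1 k).1)
    (fun k => descends_shannon hm hS hS' (hB.1 k).1) (mul_pos hε hn')
  have hsel : IsSelector (joinN S U n) fun y => B (J y) y := ⟨hJ, fun y => (hB.1 (J y)).2 y⟩
  calc hMinusC (P.bind m) S U ≤ rate (P.bind m) (S^[n]) (fun y => B (J y) y) / n :=
        hsel.hMinusC_le _ (measurePreserving_bind P hm hS' hmp) hU hn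
    _ = (∫ ω, rate (m ω) (S^[n]) (fun y => B (J y) y) ∂P) / n := by
        rw [rate_bind_eq_integral P hm (hS'.iterate n) hmpn hJ]
    _ ≤ (∫ ω, (entCover (m ω) (joinN S U n) + ε * n) ∂P) / n := by
        gcongr ?_ / _
        refine integral_mono_ae (integrable_rate P hm hmpn hJ)
          ((integrable_entCover P hm hV).add (integrable_const _)) ?_
        filter_upwards [hopt] with ω ⟨k, hk, hle⟩
        rw [rate_congr (m ω) (hmpn ω) hk, hB.entCover_eq (m ω) hV]
        exact (rate_le_shannon (m ω) (hmpn ω) (hB.1 k).1).trans hle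
    _ = (∫ ω, entCover (m ω) (joinN S U n) ∂P) / n + ε := by
        rw [integral_add (integrable_entCover P hm hV) (integrable_const _), add_div]
        simp [hn'.ne']

theorem hMinusC_bind (hm : Measurable m) (hS : ∀ ω, Ergodic S (m ω)) (hU : IsMCover U) :
    hMinusC (P.bind m) S U = ∫ ω, hMinusC (m ω) S U ∂P := by
  have ⟨ω₀⟩ := nonempty_of_isProbabilityMeasure P
  have := isProbabilityMeasure_bind_of_forall P hm
  have hS' := (hS ω₀).measurable
  have hmp := fun ω => (hS ω).toMeasurePreserving
  have hlim := tendsto_integral_entCover_joinN P hm hmp hU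
  refine le_antisymm (ge_of_tendsto hlim ?_) (le_of_tendsto_of_tendsto' hlim
    (tendsto_hMinusC (P.bind m) (measurePreserving_bind P hm hS' hmp) hU) fun n => ?_)
  · filter_upwards [eventually_gt_atTop 0] with n hn
    exact hMinusC_bind_le P hm hS hU hn
  · gcongr
    exact integral_entCover_le P hm (hU.joinN hS' n)

end ErgodicDecomposition

/-- **Ergodic decomposition of cover entropies.** If
`μ = ∫ μ_x dμ(x)` is the ergodic decomposition of `μ` with respect to `T`, then
`h_μ⁺(𝓤, T) = ∫ h_{μ_x}⁺(𝓤, T) dμ(x)` and `h_μ⁻(𝓤, T) = ∫ h_{μ_x}⁻(𝓤, T) dμ(x)`. -/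
theorem ergodic_decomposition_cover_entropy {X : Type*} [MeasurableSpace X]
    [StandardBorelSpace X]
    (μ : Measure X) [IsProbabilityMeasure μ] (T : X ≃ᵐ X)
    (hT : MeasurePreserving ⇑T μ μ)
    (U : Finset (Set X)) (hU : IsMCover U)
    (m : X → Measure X)
    (hprob : ∀ x, IsProbabilityMeasure (m x))
    (herg : ∀ x, Ergodic ⇑T (m x))
    (hmeas : ∀ s : Set X, MeasurableSet s → Measurable fun x => m x s)
    (hdecomp : ∀ s : Set X, MeasurableSet s → μ s = ∫⁻ x, m x s ∂μ) :
    hPlusC μ ⇑T U = ∫ x, hPlusC (m x) ⇑T U ∂μ ∧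
    hMinusC μ ⇑T U = ∫ x, hMinusC (m x) ⇑T U ∂μ := by
  have hm : Measurable m := Measure.measurable_of_measurable_coe m hmeas
  have hμ : μ.bind m = μ := Measure.ext fun s hs => by
    rw [Measure.bind_apply hs hm.aemeasurable, hdecomp s hs]
  have hplus := hPlusC_bind μ hm herg hU
  have hminus := hMinusC_bind μ hm herg hU
  rw [hμ] at hplus hminus
  exact ⟨hplus, hminus⟩
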